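/- Let n ∈ ℕ with 3 ∤ n. Then H_{0,3}(n) = (1/2)·σ(n) if n ≡ 1 (mod 3), and H_{0,3}(n) = σ(n) − 2·∑_{d∣n, d²<n} d if n ≡ 2 (mod 3). -/

import Mathlib

open scoped BigOperators

namespace HurwitzPaper

/-- Evaluation of the binary quadratic form `(a,b,c)` (i.e. `a x² + b x y + c y²`). -/
def formEval (Q : ℤ × ℤ × ℤ) (x y : ℤ) : ℤ :=
  Q.1 * x ^ 2 + Q.2.1 * x * y + Q.2.2 * y ^ 2

/-- Discriminant `b² - 4ac` of the form `(a,b,c)`. -/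
def formDisc (Q : ℤ × ℤ × ℤ) : ℤ := Q.2.1 ^ 2 - 4 * Q.1 * Q.2.2

/-- Right action of `γ ∈ SL₂(ℤ)` on a binary quadratic form: `(Q∘γ)(x,y) = Q(ax+by, cx+dy)`. -/
def formAct (γ : Matrix.SpecialLinearGroup (Fin 2) ℤ) (Q : ℤ × ℤ × ℤ) : ℤ × ℤ × ℤ :=
  (formEval Q (γ.1 0 0) (γ.1 1 0),
   formEval Q (γ.1 0 0 + γ.1 0 1) (γ.1 1 0 + γ.1 1 1)
     - formEval Q (γ.1 0 0) (γ.1 1 0) - formEval Q (γ.1 0 1) (γ.1 1 1),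
   formEval Q (γ.1 0 1) (γ.1 1 1))

/-- A form is positive definite iff its leading coefficient is positive and its
discriminant is negative. -/
def IsPosDef (Q : ℤ × ℤ × ℤ) : Prop := 0 < Q.1 ∧ formDisc Q < 0

/-- `SL₂(ℤ)`-equivalence classes of positive definite integral binary quadratic forms
of discriminant `-N`. -/
abbrev FormClasses (N : ℤ) :=
  Quot (fun (Q Q' : {Q : ℤ × ℤ × ℤ // formDisc Q = -N ∧ IsPosDef Q}) =>
    ∃ γ : Matrix.SpecialLinearGroup (Fin 2) ℤ, formAct γ Q.1 = Q'.1)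

/-- The Hurwitz class number `H(N)`: each class of positive definite forms of
discriminant `-N` is counted with weight `1/ω_Q = 2/#Γ_Q`, where `Γ_Q` is the stabilizer
of (a representative of) the class in `SL₂(ℤ)`; `H(0) = -1/12`, and `H(N) = 0` when no
such forms exist (in particular for `N < 0` and `N ≡ 1, 2 (mod 4)`). -/
noncomputable def hurwitzClassNumber (N : ℤ) : ℝ :=
  if N = 0 then -(1 / 12)
  else ∑ᶠ c : FormClasses N,
    (2 : ℝ) / (Nat.card {γ : Matrix.SpecialLinearGroup (Fin 2) ℤ //
      formAct γ c.out.1 = c.out.1})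

/-- `H_{κ,m,M}(n) = ∑_{t ≡ m (mod M)} t^κ H(4n - t²)`. -/
noncomputable def HH (κ : ℕ) (m : ℤ) (M : ℕ) (n : ℕ) : ℝ :=
  ∑ᶠ t : ℤ, if t % (M : ℤ) = m % (M : ℤ) then
    (t : ℝ) ^ κ * hurwitzClassNumber (4 * n - t ^ 2) else 0

/-- `a(n)`: the `n`-th Fourier coefficient of `η(3τ)⁸ = q ∏_{k≥1} (1-q^{3k})⁸`
(the factors with `k > n` do not affect the coefficient of `q^n`). -/
noncomputable def etaCoeff (n : ℕ) : ℤ :=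
  Polynomial.coeff (Polynomial.X * ∏ k ∈ Finset.Icc 1 n, (1 - Polynomial.X ^ (3 * k)) ^ 8 : Polynomial ℤ) n



/-- residue code -/
def cdv (P C Z Q : ℕ) : ℕ :=
  min (27 * (P % 3) + 9 * (C % 3) + 3 * (Z % 3) + Q % 3)
    (27 * (2 * P % 3) + 9 * (2 * C % 3) + 3 * (2 * Z % 3) + 2 * Q % 3)

/-- list lookup -/
def lk : List (ℕ × ℤ) → ℕ → ℤ
  | [], _ => 0
  | (a, b) :: l, k => bif Nat.beq a k then b else lk l k

/-- table lookup -/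
def tb (l : List (ℕ × ℤ)) (P C Z Q : ℕ) : ℤ := lk l (cdv P C Z Q)

/-- indicator of a residue -/
def dd (r x : ℕ) : ℤ := bif Nat.beq (x % 3) r then 1 else 0

/-- comparison -/
def cm (a b : ℤ) : ℕ := if a < b then 0 else if a = b then 1 else 2

/-- the certificate, in terms of the signs of `c-p`, `q-z`, `c-p-z`, `c-p-z-q` -/
def cG (s t u v : ℕ) (P C Z Q : ℕ) : ℤ :=
  if s < 2 then (if t = 0 then tb [(13,2), (14,4), (16,6), (32,4), (34,6), (35,2), (36,2), (37,2), (38,2), (39,2), (42,2), (46,2), (47,2), (50,2), (52,2)] P C Z Q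
    else if t = 1 then tb [(13,1), (35,1), (36,1)] P C Z Q
    else tb [(14,4), (16,6), (32,4), (34,6), (46,2), (47,2)] P C Z Q)
  else if u = 0 then (if t = 0 then tb [(13,-2), (17,-2), (31,-4), (36,2), (37,2), (38,2), (39,2), (42,2), (50,2), (52,2)] P C Z Q
    else if t = 1 then tb [(13,-3), (17,-2), (31,-4), (35,-1), (36,1)] P C Z Q
    else tb [(13,-4), (17,-2), (31,-4), (35,-2)] P C Z Q)
  else if u = 1 then (if t = 0 then tb [(13,-2), (48,-4), (50,-2)] P C Z Q
    else if t = 1 then tb [(13,-2)] P C Z Q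
    else tb [(36,2), (50,2)] P C Z Q)
  else if v = 0 then (if t = 0 then tb [(4,-4), (13,1), (14,4), (32,-2), (34,-1), (35,1), (36,1), (37,1), (38,4), (40,4), (42,8), (46,-4), (47,-1), (48,-4), (51,-2)] P C Z Q
    else if t = 1 then 0
    else tb [(4,4), (13,-1), (16,-4), (32,-1), (35,-1), (36,-1), (38,-6), (39,-1), (40,-4), (42,-2), (47,-4), (50,-2), (51,-5), (52,-2)] P C Z Q)
  else if v = 1 then (if t = 0 then tb [(5,10), (17,4), (31,4)] P C Z Q
    else if t = 1 then tb [(17,4)] P C Z Q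
    else tb [(5,2), (17,4), (31,-4)] P C Z Q)
  else (if t = 0 then tb [(5,4), (14,4), (16,4), (31,4), (32,-4), (34,-2), (38,4), (40,4), (42,2), (46,-2), (47,-2), (48,-4), (51,-2), (52,-4)] P C Z Q
    else if t = 1 then 0
    else tb [(5,-4), (14,-4), (16,-4), (31,-4), (34,2), (40,-4), (42,-2), (47,-4), (48,-2), (50,2), (51,-4), (52,-2)] P C Z Q)

/-- tie weight at `q = c` -/
def tieT (P C M : ℕ) : ℤ :=
  - dd 1 M - dd 2 M * (2 - dd 1 C * (2 * (dd 1 P - dd 0 P)) + dd 2 C * (2 * (dd 1 P - dd 2 P)))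

/-- the full weight without the certificate -/
def cT (p c z q : ℤ) (P C Z Q : ℕ) : ℤ :=
  (if cm c (p + z) = 0 ∧ cm c (p + q) = 0 ∧ cm p (c + z) < 2 ∧ cm p (c + q) < 2
    then 2 * dd 0 (P + C) else 0)
  + (if cm q c = 0 ∧ cm c (p + q) < 2 ∧ cm z q < 2 then dd 0 (Z + 2 * C + Q) else 0)
  + (if cm q c = 0 ∧ cm c (p + q) = 0 ∧ cm z q = 0 then dd 0 (Z + 2 * C + Q) else 0)
  + (if cm p (c + z + q) = 1 then 4 * dd 0 C + 2 * dd 2 (P * C + Z * Q) else 0)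
  + (if cm q c = 1 then tieT P C (P * C + Z * Q) else 0)

/-- the total weight -/
def cK (p c z q : ℤ) (P C Z Q : ℕ) : ℤ :=
  cT p c z q P C Z Q
  - (if cm q c = 0 then cG (cm c p) (cm q z) (cm c (p + z)) (cm c (p + z + q)) P C Z Q else 0)
  + (if cm p z = 0 then cG (cm (c + q) p) (cm (p + q) z) (cm (c + q) z) (cm c z)
      P (C + Q) (Z + 2 * P) Q else 0)

/-- symmetrization -/
def cS (p c z q : ℤ) (P C Z Q : ℕ) : ℤ :=
  cK p c z q P C Z Q + cK c p z q C P Z Q + cK p c q z P C Q Z + cK c p q z C P Q Z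
  + cK z q p c Z Q P C + cK z q c p Z Q C P + cK q z p c Q Z P C + cK q z c p Q Z C P

theorem cm_cases {a b : ℤ} {R : Prop} (e : a = b → R) :
    (a < b ∧ cm a b = 0) ∨ (a = b ∧ R ∧ cm a b = 1) ∨ (b < a ∧ cm a b = 2) := by
  unfold cm
  rcases lt_trichotomy a b with h | h | h
  · exact Or.inl ⟨h, by rw [if_pos h]⟩
  · exact Or.inr (Or.inl ⟨h, e h, by rw [if_neg (by omega), if_pos h]⟩)
  · exact Or.inr (Or.inr ⟨h, by rw [if_neg (by omega), if_neg (by omega)]⟩)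

set_option maxHeartbeats 4000000 in
set_option synthInstance.maxHeartbeats 400000 in
set_option synthInstance.maxSize 1000 in
theorem cS_fd (p c z q : ℤ) (P C Z Q : Fin 3) (hc : 0 < c) (hz : 0 < z) (hq : 0 < q)
    (hpc : c ≤ p) (hpz : z ≤ p) (hzq : q ≤ z)
    (hn : (P.1 * C.1 + Z.1 * Q.1) % 3 ≠ 0)
    (e1 : p = c → P.1 = C.1) (e2 : p = z → P.1 = Z.1) (e3 : z = q → Z.1 = Q.1) (e4 : c = z → C.1 = Z.1)
    (e5 : c = q → C.1 = Q.1) (e6 : p = c + z → P.1 = (C.1 + Z.1) % 3) (e7 : p = c + q → P.1 = (C.1 + Q.1) % 3)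
    (e8 : z = c + q → Z.1 = (C.1 + Q.1) % 3) (e9 : p = c + z + q → P.1 = (C.1 + Z.1 + Q.1) % 3) :
    cS p c z q P.1 C.1 Z.1 Q.1 = 0 := by
  have x0 : cm c p = 2 - cm p c := by unfold cm; split_ifs <;> omega
  have x1 : cm c (p + q) = 0 := by unfold cm; split_ifs <;> omega
  have x2 : cm c (p + q + z) = 0 := by unfold cm; split_ifs <;> omega
  have x3 : cm c (p + z) = 0 := by unfold cm; split_ifs <;> omega
  have x4 : cm c (p + z + q) = 0 := by unfold cm; split_ifs <;> omega
  have x7 : cm (c + q) p = 2 - cm p (c + q) := by unfold cm; split_ifs <;> omega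
  have x8 : cm (c + q) z = 2 - cm z (c + q) := by unfold cm; split_ifs <;> omega
  have x9 : cm (c + z) p = 2 - cm p (c + z) := by unfold cm; split_ifs <;> omega
  have x10 : cm (c + z) q = 2 := by unfold cm; split_ifs <;> omega
  have x13 : cm p (c + q + z) = cm p (c + z + q) := by unfold cm; split_ifs <;> omega
  have x18 : cm (p + q) c = 2 := by unfold cm; split_ifs <;> omega
  have x19 : cm (p + q) z = 2 := by unfold cm; split_ifs <;> omega
  have x20 : cm (p + z) c = 2 := by unfold cm; split_ifs <;> omega
  have x21 : cm (p + z) q = 2 := by unfold cm; split_ifs <;> omega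
  have x22 : cm q c = 2 - cm c q := by unfold cm; split_ifs <;> omega
  have x23 : cm q p = 2 - cm p q := by unfold cm; split_ifs <;> omega
  have x24 : cm q z = 2 - cm z q := by unfold cm; split_ifs <;> omega
  have x25 : cm q (z + c) = 0 := by unfold cm; split_ifs <;> omega
  have x26 : cm q (z + c + p) = 0 := by unfold cm; split_ifs <;> omega
  have x27 : cm q (z + p) = 0 := by unfold cm; split_ifs <;> omega
  have x28 : cm q (z + p + c) = 0 := by unfold cm; split_ifs <;> omega
  have x29 : cm (q + c) p = 2 - cm p (c + q) := by unfold cm; split_ifs <;> omega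
  have x30 : cm (q + c) z = 2 - cm z (c + q) := by unfold cm; split_ifs <;> omega
  have x31 : cm (q + p) c = 2 := by unfold cm; split_ifs <;> omega
  have x32 : cm (q + p) z = 2 := by unfold cm; split_ifs <;> omega
  have x33 : cm z c = 2 - cm c z := by unfold cm; split_ifs <;> omega
  have x34 : cm z p = 2 - cm p z := by unfold cm; split_ifs <;> omega
  have x36 : cm z (q + c) = cm z (c + q) := by unfold cm; split_ifs <;> omega
  have x37 : cm z (q + c + p) = 0 := by unfold cm; split_ifs <;> omega
  have x38 : cm z (q + p) = 0 := by unfold cm; split_ifs <;> omega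
  have x39 : cm z (q + p + c) = 0 := by unfold cm; split_ifs <;> omega
  have x40 : cm (z + c) p = 2 - cm p (c + z) := by unfold cm; split_ifs <;> omega
  have x41 : cm (z + c) q = 2 := by unfold cm; split_ifs <;> omega
  have x42 : cm (z + p) c = 2 := by unfold cm; split_ifs <;> omega
  have x43 : cm (z + p) q = 2 := by unfold cm; split_ifs <;> omega
  unfold cS cK cT
  simp only [x0, x1, x2, x3, x4, x7, x8, x9, x10, x13, x18, x19, x20, x21, x22, x23, x24, x25, x26, x27, x28, x29, x30, x31, x32, x33, x34, x36, x37, x38, x39, x40, x41, x42, x43]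
  clear x0 x1 x2 x3 x4 x7 x8 x9 x10 x13 x18 x19 x20 x21 x22 x23 x24 x25 x26 x27 x28 x29 x30 x31 x32 x33 x34 x36 x37 x38 x39 x40 x41 x42 x43
  revert P C Z Q
  intro P C Z Q hn e1 e2 e3 e4 e5 e6 e7 e8 e9
  rcases cm_cases e1 with ⟨h0, t0⟩ | ⟨h0, k0, t0⟩ | ⟨h0, t0⟩ <;>
    try (exfalso; clear * - hc hz hq hpc hpz hzq h0; omega)
  all_goals rcases cm_cases e3 with ⟨h1, t1⟩ | ⟨h1, k1, t1⟩ | ⟨h1, t1⟩ <;>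
    try (exfalso; clear * - hc hz hq hpc hpz hzq h0 h1; omega)
  all_goals rcases cm_cases e4 with ⟨h2, t2⟩ | ⟨h2, k2, t2⟩ | ⟨h2, t2⟩ <;>
    try (exfalso; clear * - hc hz hq hpc hpz hzq h0 h1 h2; omega)
  all_goals rcases cm_cases e5 with ⟨h3, t3⟩ | ⟨h3, k3, t3⟩ | ⟨h3, t3⟩ <;>
    try (exfalso; clear * - hc hz hq hpc hpz hzq h0 h1 h2 h3; omega)
  all_goals rcases cm_cases e2 with ⟨h4, t4⟩ | ⟨h4, k4, t4⟩ | ⟨h4, t4⟩ <;>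
    try (exfalso; clear * - hc hz hq hpc hpz hzq h0 h1 h2 h3 h4; omega)
  all_goals rcases cm_cases (fun _ => trivial : p = q → True) with ⟨h5, t5⟩ | ⟨h5, k5, t5⟩ | ⟨h5, t5⟩ <;>
    try (exfalso; clear * - hc hz hq hpc hpz hzq h0 h1 h2 h3 h4 h5; omega)
  all_goals rcases cm_cases e6 with ⟨h6, t6⟩ | ⟨h6, k6, t6⟩ | ⟨h6, t6⟩ <;>
    try (exfalso; clear * - hc hz hq hpc hpz hzq h0 h1 h2 h3 h4 h5 h6; omega)
  all_goals rcases cm_cases e7 with ⟨h7, t7⟩ | ⟨h7, k7, t7⟩ | ⟨h7, t7⟩ <;>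
    try (exfalso; clear * - hc hz hq hpc hpz hzq h0 h1 h2 h3 h4 h5 h6 h7; omega)
  all_goals rcases cm_cases e8 with ⟨h8, t8⟩ | ⟨h8, k8, t8⟩ | ⟨h8, t8⟩ <;>
    try (exfalso; clear * - hc hz hq hpc hpz hzq h0 h1 h2 h3 h4 h5 h6 h7 h8; omega)
  all_goals rcases cm_cases e9 with ⟨h9, t9⟩ | ⟨h9, k9, t9⟩ | ⟨h9, t9⟩ <;>
    try (exfalso; clear * - hc hz hq hpc hpz hzq h0 h1 h2 h3 h4 h5 h6 h7 h8 h9; omega)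
  all_goals
    clear e1 e2 e3 e4 e5 e6 e7 e8 e9
    simp only [t0, t1, t2, t3, t4, t5, t6, t7, t8, t9]
    clear t0 t1 t2 t3 t4 t5 t6 t7 t8 t9
    revert P C Z Q
    decide +kernel


/-- residue -/
def rr (x : ℤ) : ℕ := (x % 3).toNat

theorem rr_lt (x : ℤ) : rr x < 3 := by unfold rr; omega

theorem cS_zero (p c z q : ℤ) (hp : 0 < p) (hc : 0 < c) (hz : 0 < z) (hq : 0 < q)
    (hn : (rr p * rr c + rr z * rr q) % 3 ≠ 0) :
    cS p c z q (rr p) (rr c) (rr z) (rr q) = 0 := by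
  have key : ∀ p c z q : ℤ, 0 < p → 0 < c → 0 < z → 0 < q → c ≤ p → z ≤ p → q ≤ z →
      (rr p * rr c + rr z * rr q) % 3 ≠ 0 → cS p c z q (rr p) (rr c) (rr z) (rr q) = 0 := by
    intro p c z q hp hc hz hq h1 h2 h3 hn
    refine cS_fd p c z q ⟨rr p, rr_lt p⟩ ⟨rr c, rr_lt c⟩ ⟨rr z, rr_lt z⟩ ⟨rr q, rr_lt q⟩
      hc hz hq h1 h2 h3 hn ?_ ?_ ?_ ?_ ?_ ?_ ?_ ?_ ?_ <;>
      (intro h; simp only [rr]; omega)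
  have s1 : ∀ p c z q : ℤ, cS p c z q (rr p) (rr c) (rr z) (rr q)
      = cS c p z q (rr c) (rr p) (rr z) (rr q) := by
    intro p c z q; unfold cS; ring
  have s2 : ∀ p c z q : ℤ, cS p c z q (rr p) (rr c) (rr z) (rr q)
      = cS p c q z (rr p) (rr c) (rr q) (rr z) := by
    intro p c z q; unfold cS; ring
  have s3 : ∀ p c z q : ℤ, cS p c z q (rr p) (rr c) (rr z) (rr q)
      = cS z q p c (rr z) (rr q) (rr p) (rr c) := by
    intro p c z q; unfold cS; ring
  have k1 : ∀ p c z q : ℤ, 0 < p → 0 < c → 0 < z → 0 < q → c ≤ p → q ≤ z →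
      (rr p * rr c + rr z * rr q) % 3 ≠ 0 → cS p c z q (rr p) (rr c) (rr z) (rr q) = 0 := by
    intro p c z q hp hc hz hq h1 h3 hn
    rcases le_total z p with h | h
    · exact key p c z q hp hc hz hq h1 h h3 hn
    · rw [s3]; exact key z q p c hz hq hp hc h3 h h1 (by rwa [add_comm] at hn)
  have k2 : ∀ p c z q : ℤ, 0 < p → 0 < c → 0 < z → 0 < q → c ≤ p →
      (rr p * rr c + rr z * rr q) % 3 ≠ 0 → cS p c z q (rr p) (rr c) (rr z) (rr q) = 0 := by
    intro p c z q hp hc hz hq h1 hn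
    rcases le_total q z with h | h
    · exact k1 p c z q hp hc hz hq h1 h hn
    · rw [s2]; exact k1 p c q z hp hc hq hz h1 h (by rwa [mul_comm (rr z)] at hn)
  rcases le_total c p with h | h
  · exact k2 p c z q hp hc hz hq h hn
  · rw [s1]; exact k2 c p z q hc hp hz hq h (by rwa [mul_comm (rr p)] at hn)

/-- the set of representations `p c + z q = n` -/
noncomputable def PP (n : ℕ) : Finset (ℤ × ℤ × ℤ × ℤ) :=
  (Finset.Icc (1 : ℤ) n ×ˢ Finset.Icc (1 : ℤ) n ×ˢ Finset.Icc (1 : ℤ) n ×ˢ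
    Finset.Icc (1 : ℤ) n).filter (fun x => x.1 * x.2.1 + x.2.2.1 * x.2.2.2 = n)

theorem mem_PP {n : ℕ} {p c z q : ℤ} : (p, c, z, q) ∈ PP n ↔
    0 < p ∧ 0 < c ∧ 0 < z ∧ 0 < q ∧ p * c + z * q = n := by
  simp only [PP, Finset.mem_filter, Finset.mem_product, Finset.mem_Icc]
  constructor
  · rintro ⟨⟨h1, h2, h3, h4⟩, h⟩
    exact ⟨by omega, by omega, by omega, by omega, h⟩
  · rintro ⟨h1, h2, h3, h4, h⟩
    refine ⟨⟨⟨h1, ?_⟩, ⟨h2, ?_⟩, ⟨h3, ?_⟩, ⟨h4, ?_⟩⟩, h⟩ <;>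
      nlinarith [mul_pos h1 h2, mul_pos h3 h4]

/-- sum over `PP n` -/
noncomputable def SS (n : ℕ) (F : ℤ → ℤ → ℤ → ℤ → ℤ) : ℤ :=
  ∑ x ∈ PP n, F x.1 x.2.1 x.2.2.1 x.2.2.2

theorem SS_add (n : ℕ) (F G : ℤ → ℤ → ℤ → ℤ → ℤ) :
    SS n (fun p c z q => F p c z q + G p c z q) = SS n F + SS n G := by
  simp only [SS, Finset.sum_add_distrib]

theorem SS_sub (n : ℕ) (F G : ℤ → ℤ → ℤ → ℤ → ℤ) :
    SS n (fun p c z q => F p c z q - G p c z q) = SS n F - SS n G := by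
  simp only [SS, Finset.sum_sub_distrib]

theorem SS_congr {n : ℕ} {F G : ℤ → ℤ → ℤ → ℤ → ℤ}
    (h : ∀ p c z q : ℤ, 0 < p → 0 < c → 0 < z → 0 < q → p * c + z * q = (n : ℤ) → F p c z q = G p c z q) :
    SS n F = SS n G := by
  refine Finset.sum_congr rfl ?_
  rintro ⟨p, c, z, q⟩ hx
  obtain ⟨h1, h2, h3, h4, h5⟩ := mem_PP.1 hx
  exact h p c z q h1 h2 h3 h4 h5

theorem SS_swap1 (n : ℕ) (F : ℤ → ℤ → ℤ → ℤ → ℤ) :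
    SS n (fun p c z q => F c p z q) = SS n F := by
  refine Finset.sum_nbij' (fun x => (x.2.1, x.1, x.2.2.1, x.2.2.2))
    (fun x => (x.2.1, x.1, x.2.2.1, x.2.2.2)) ?_ ?_ ?_ ?_ ?_
  · rintro ⟨p, c, z, q⟩ hx
    obtain ⟨h1, h2, h3, h4, h5⟩ := mem_PP.1 hx
    exact mem_PP.2 ⟨h2, h1, h3, h4, by linarith⟩
  · rintro ⟨p, c, z, q⟩ hx
    obtain ⟨h1, h2, h3, h4, h5⟩ := mem_PP.1 hx
    exact mem_PP.2 ⟨h2, h1, h3, h4, by linarith⟩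
  all_goals intros; rfl

theorem SS_swap2 (n : ℕ) (F : ℤ → ℤ → ℤ → ℤ → ℤ) :
    SS n (fun p c z q => F p c q z) = SS n F := by
  refine Finset.sum_nbij' (fun x => (x.1, x.2.1, x.2.2.2, x.2.2.1))
    (fun x => (x.1, x.2.1, x.2.2.2, x.2.2.1)) ?_ ?_ ?_ ?_ ?_
  · rintro ⟨p, c, z, q⟩ hx
    obtain ⟨h1, h2, h3, h4, h5⟩ := mem_PP.1 hx
    exact mem_PP.2 ⟨h1, h2, h4, h3, by linarith⟩
  · rintro ⟨p, c, z, q⟩ hx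
    obtain ⟨h1, h2, h3, h4, h5⟩ := mem_PP.1 hx
    exact mem_PP.2 ⟨h1, h2, h4, h3, by linarith⟩
  all_goals intros; rfl

theorem SS_swap3 (n : ℕ) (F : ℤ → ℤ → ℤ → ℤ → ℤ) :
    SS n (fun p c z q => F z q p c) = SS n F := by
  refine Finset.sum_nbij' (fun x => (x.2.2.1, x.2.2.2, x.1, x.2.1))
    (fun x => (x.2.2.1, x.2.2.2, x.1, x.2.1)) ?_ ?_ ?_ ?_ ?_
  · rintro ⟨p, c, z, q⟩ hx
    obtain ⟨h1, h2, h3, h4, h5⟩ := mem_PP.1 hx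
    exact mem_PP.2 ⟨h3, h4, h1, h2, by linarith⟩
  · rintro ⟨p, c, z, q⟩ hx
    obtain ⟨h1, h2, h3, h4, h5⟩ := mem_PP.1 hx
    exact mem_PP.2 ⟨h3, h4, h1, h2, by linarith⟩
  all_goals intros; rfl

theorem SS_move (n : ℕ) (F : ℤ → ℤ → ℤ → ℤ → ℤ) :
    SS n (fun p c z q => if q < c then F p c z q else 0)
      = SS n (fun p c z q => if p < z then F p (c + q) (z - p) q else 0) := by
  unfold SS
  rw [← Finset.sum_filter, ← Finset.sum_filter]
  refine Finset.sum_nbij' (fun x => (x.1, x.2.1 - x.2.2.2, x.2.2.1 + x.1, x.2.2.2))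
    (fun x => (x.1, x.2.1 + x.2.2.2, x.2.2.1 - x.1, x.2.2.2)) ?_ ?_ ?_ ?_ ?_
  · rintro ⟨p, c, z, q⟩ hx
    obtain ⟨hx, h⟩ := Finset.mem_filter.1 hx
    obtain ⟨h1, h2, h3, h4, h5⟩ := mem_PP.1 hx
    refine Finset.mem_filter.2 ⟨mem_PP.2 ⟨h1, ?_, ?_, h4, ?_⟩, ?_⟩ <;> simp only at h ⊢
    · omega
    · omega
    · linarith
    · omega
  · rintro ⟨p, c, z, q⟩ hx
    obtain ⟨hx, h⟩ := Finset.mem_filter.1 hx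
    obtain ⟨h1, h2, h3, h4, h5⟩ := mem_PP.1 hx
    refine Finset.mem_filter.2 ⟨mem_PP.2 ⟨h1, ?_, ?_, h4, ?_⟩, ?_⟩ <;> simp only at h ⊢
    · omega
    · omega
    · linarith
    · omega
  · rintro ⟨p, c, z, q⟩ _
    simp
  · rintro ⟨p, c, z, q⟩ _
    simp
  · rintro ⟨p, c, z, q⟩ _
    simp

theorem tb_congr (l : List (ℕ × ℤ)) {P C Z Q P' C' Z' Q' : ℕ} (h1 : P % 3 = P' % 3)
    (h2 : C % 3 = C' % 3) (h3 : Z % 3 = Z' % 3) (h4 : Q % 3 = Q' % 3) :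
    tb l P C Z Q = tb l P' C' Z' Q' := by
  unfold tb cdv
  rw [h1, h2, h3, h4, show 2 * P % 3 = 2 * P' % 3 by omega, show 2 * C % 3 = 2 * C' % 3 by omega,
    show 2 * Z % 3 = 2 * Z' % 3 by omega, show 2 * Q % 3 = 2 * Q' % 3 by omega]

theorem cG_congr (s t u v : ℕ) {P C Z Q P' C' Z' Q' : ℕ} (h1 : P % 3 = P' % 3)
    (h2 : C % 3 = C' % 3) (h3 : Z % 3 = Z' % 3) (h4 : Q % 3 = Q' % 3) :
    cG s t u v P C Z Q = cG s t u v P' C' Z' Q' := by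
  unfold cG
  simp only [tb_congr _ h1 h2 h3 h4]

theorem cm_congr {a b a' b' : ℤ} (h : a - b = a' - b') : cm a b = cm a' b' := by
  unfold cm; split_ifs <;> omega

theorem cm_eq_zero {a b : ℤ} : cm a b = 0 ↔ a < b := by
  unfold cm; split_ifs <;> simp_all

theorem cm_lt_two {a b : ℤ} : cm a b < 2 ↔ a ≤ b := by
  unfold cm; split_ifs <;> simp <;> omega

theorem cm_eq_one {a b : ℤ} : cm a b = 1 ↔ a = b := by
  unfold cm; split_ifs <;> simp <;> omega

theorem rr_mod {n : ℕ} {p c z q : ℤ} (h : p * c + z * q = n) :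
    (rr p * rr c + rr z * rr q) % 3 = n % 3 := by
  have h1 : ∀ x : ℤ, ((rr x : ℕ) : ℤ) ≡ x [ZMOD 3] := by
    intro x; unfold rr Int.ModEq; omega
  have : ((rr p * rr c + rr z * rr q : ℕ) : ℤ) ≡ n [ZMOD 3] := by
    rw [← h]; push_cast
    exact ((h1 p).mul (h1 c)).add ((h1 z).mul (h1 q))
  unfold Int.ModEq at this
  omega

/-- the certificate identity -/
theorem SS_cT (n : ℕ) (h3 : ¬ 3 ∣ n) :
    SS n (fun p c z q => cT p c z q (rr p) (rr c) (rr z) (rr q)) = 0 := by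
  set K : ℤ → ℤ → ℤ → ℤ → ℤ := fun p c z q => cK p c z q (rr p) (rr c) (rr z) (rr q) with hK
  have hsym : SS n (fun p c z q => K p c z q + K c p z q + K p c q z + K c p q z
      + K z q p c + K z q c p + K q z p c + K q z c p) = 0 := by
    have : SS n (fun _ _ _ _ => 0) = 0 := by simp [SS]
    rw [← this]
    apply SS_congr
    intro p c z q h1 h2 h3' h4 h5
    have := cS_zero p c z q h1 h2 h3' h4 (by rw [rr_mod h5]; omega)
    rw [← this]; rfl
  have a1 : SS n (fun p c z q => K c p z q) = SS n K := SS_swap1 n K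
  have a2 : SS n (fun p c z q => K p c q z) = SS n K := SS_swap2 n K
  have a3 : SS n (fun p c z q => K c p q z) = SS n K := by
    rw [SS_swap1 n (fun p c z q => K p c q z), a2]
  have a4 : SS n (fun p c z q => K z q p c) = SS n K := SS_swap3 n K
  have a5 : SS n (fun p c z q => K z q c p) = SS n K := by
    rw [SS_swap3 n (fun p c z q => K p c q z), a2]
  have a6 : SS n (fun p c z q => K q z p c) = SS n K := by
    rw [SS_swap3 n (fun p c z q => K c p z q), a1]
  have a7 : SS n (fun p c z q => K q z c p) = SS n K := by
    rw [SS_swap3 n (fun p c z q => K c p q z), a3]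
  have hK0 : SS n K = 0 := by
    rw [SS_add n (fun p c z q => K p c z q + K c p z q + K p c q z + K c p q z
      + K z q p c + K z q c p + K q z p c) (fun p c z q => K q z c p),
      SS_add n (fun p c z q => K p c z q + K c p z q + K p c q z + K c p q z
      + K z q p c + K z q c p) (fun p c z q => K q z p c),
      SS_add n (fun p c z q => K p c z q + K c p z q + K p c q z + K c p q z
      + K z q p c) (fun p c z q => K z q c p),
      SS_add n (fun p c z q => K p c z q + K c p z q + K p c q z + K c p q z)
        (fun p c z q => K z q p c),
      SS_add n (fun p c z q => K p c z q + K c p z q + K p c q z) (fun p c z q => K c p q z),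
      SS_add n (fun p c z q => K p c z q + K c p z q) (fun p c z q => K p c q z),
      SS_add n (fun p c z q => K p c z q) (fun p c z q => K c p z q),
      a1, a2, a3, a4, a5, a6, a7] at hsym
    linarith
  have hmove := SS_move n (fun p c z q =>
    cG (cm c p) (cm q z) (cm c (p + z)) (cm c (p + z + q)) (rr p) (rr c) (rr z) (rr q))
  have e : SS n K = SS n (fun p c z q => cT p c z q (rr p) (rr c) (rr z) (rr q))
      - SS n (fun p c z q => if q < c then
          cG (cm c p) (cm q z) (cm c (p + z)) (cm c (p + z + q)) (rr p) (rr c) (rr z) (rr q) else 0)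
      + SS n (fun p c z q => if p < z then
          cG (cm (c + q) p) (cm q (z - p)) (cm (c + q) (p + (z - p))) (cm (c + q) (p + (z - p) + q))
            (rr p) (rr (c + q)) (rr (z - p)) (rr q) else 0) := by
    rw [← SS_sub, ← SS_add]
    apply SS_congr
    intro p c z q h1 h2 h3' h4 h5
    simp only [hK, cK, cm_eq_zero]
    rw [cm_congr (show q - (z - p) = p + q - z by ring),
      cm_congr (show c + q - (p + (z - p)) = c + q - z by ring),
      cm_congr (show c + q - (p + (z - p) + q) = c - z by ring)]
    rw [cG_congr (cm (c + q) p) (cm (p + q) z) (cm (c + q) z) (cm c z) (P := rr p) (C := rr c + rr q)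
      (Z := rr z + 2 * rr p) (Q := rr q) (P' := rr p) (C' := rr (c + q)) (Z' := rr (z - p))
      (Q' := rr q) rfl (by unfold rr; omega) (by unfold rr; omega) rfl]
  rw [hmove] at e
  linarith


/-- indicator of divisibility by three -/
def d0 (x : ℤ) : ℤ := if x % 3 = 0 then 1 else 0

theorem ite_d0 (P : Prop) [Decidable P] (x : ℤ) :
    (if P then d0 x else 0) = if P ∧ x % 3 = 0 then 1 else 0 := by
  by_cases h : x % 3 = 0 <;> simp [d0, h]

/-- reduced quadruples -/
noncomputable def RR (n : ℕ) : Finset (ℤ × ℤ × ℤ × ℤ) :=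
  (Finset.Icc (-(4 * n : ℤ)) (4 * n) ×ˢ Finset.Icc (-(4 * n : ℤ)) (4 * n) ×ˢ
    Finset.Icc (-(4 * n : ℤ)) (4 * n) ×ˢ Finset.Icc (-(4 * n : ℤ)) (4 * n)).filter
    (fun x => 0 < x.1 ∧ 0 < x.2.1 ∧ x.1 * x.2.1 + x.2.2.1 * x.2.2.2 = n ∧
      (x.2.2.1 + x.2.2.2) % 3 = 0 ∧ x.2.2.1 - x.2.2.2 ≤ x.1 ∧ x.2.2.1 - x.2.2.2 ≤ x.2.1 ∧
      -x.1 < x.2.2.1 - x.2.2.2 ∧ -x.2.1 < x.2.2.1 - x.2.2.2)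

theorem sq_le_of_bounds {u g h : ℤ} (hu : 0 < u) (hg : 0 < g) (h1 : h ≤ u) (h2 : h ≤ g)
    (h3 : -u ≤ h) (h4 : -g ≤ h) : h ^ 2 ≤ u * g := by
  rcases le_total 0 h with h0 | h0
  · nlinarith
  · nlinarith

theorem mem_RR {n : ℕ} {u g a d : ℤ} : (u, g, a, d) ∈ RR n ↔
    0 < u ∧ 0 < g ∧ u * g + a * d = n ∧ (a + d) % 3 = 0 ∧ a - d ≤ u ∧ a - d ≤ g ∧
      -u < a - d ∧ -g < a - d := by
  simp only [RR, Finset.mem_filter, Finset.mem_product, Finset.mem_Icc]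
  constructor
  · exact fun h => h.2
  · intro h
    refine ⟨?_, h⟩
    obtain ⟨h1, h2, h3, h4, h5, h6, h7, h8⟩ := h
    have hh := sq_le_of_bounds h1 h2 h5 h6 h7.le h8.le
    have e : 4 * (n : ℤ) ≥ 3 * (u * g) + (a + d) ^ 2 := by nlinarith
    have hug : 0 < u * g := mul_pos h1 h2
    have f1 : 3 * u ≤ 4 * n := by nlinarith [sq_nonneg (a + d)]
    have f2 : 3 * g ≤ 4 * n := by nlinarith [sq_nonneg (a + d)]
    have f3 : a + d ≤ 4 * n := by nlinarith [sq_nonneg (a + d - 1)]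
    have f4 : -(a + d) ≤ 4 * n := by nlinarith [sq_nonneg (a + d + 1)]
    refine ⟨⟨?_, ?_⟩, ⟨?_, ?_⟩, ⟨?_, ?_⟩, ⟨?_, ?_⟩⟩ <;> omega

theorem pc_pp (n : ℕ) : (∑ x ∈ RR n, if 0 < x.2.2.1 ∧ 0 < x.2.2.2 then (1 : ℤ) else 0)
    = SS n (fun p c z q => if c < p + z ∧ c < p + q ∧ p ≤ c + z ∧ p ≤ c + q ∧ (p + c) % 3 = 0
        then 1 else 0) := by
  unfold SS
  rw [← Finset.sum_filter, ← Finset.sum_filter]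
  refine Finset.sum_nbij' (fun x => (x.2.2.1, x.2.2.2, x.1, x.2.1))
    (fun x => (x.2.2.1, x.2.2.2, x.1, x.2.1)) ?_ ?_ ?_ ?_ ?_
  · rintro ⟨u, g, a, d⟩ hx
    simp only [Finset.mem_filter, mem_RR, mem_PP] at hx ⊢
    refine ⟨⟨?_, ?_, ?_, ?_, by linarith⟩, ?_⟩ <;> omega
  · rintro ⟨u, g, a, d⟩ hx
    simp only [Finset.mem_filter, mem_RR, mem_PP] at hx ⊢
    refine ⟨⟨?_, ?_, by linarith, ?_⟩, ?_⟩ <;> omega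
  all_goals intros; rfl

theorem pc_nn (n : ℕ) : (∑ x ∈ RR n, if x.2.2.1 < 0 ∧ x.2.2.2 < 0 then (1 : ℤ) else 0)
    = SS n (fun p c z q => if c < p + z ∧ c < p + q ∧ p ≤ c + z ∧ p ≤ c + q ∧ (p + c) % 3 = 0
        then 1 else 0) := by
  unfold SS
  rw [← Finset.sum_filter, ← Finset.sum_filter]
  refine Finset.sum_nbij' (fun x => (-x.2.2.2, -x.2.2.1, x.1, x.2.1))
    (fun x => (x.2.2.1, x.2.2.2, -x.2.1, -x.1)) ?_ ?_ ?_ ?_ ?_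
  · rintro ⟨u, g, a, d⟩ hx
    simp only [Finset.mem_filter, mem_RR, mem_PP] at hx ⊢
    refine ⟨⟨?_, ?_, ?_, ?_, by linarith⟩, ?_⟩ <;> omega
  · rintro ⟨u, g, a, d⟩ hx
    simp only [Finset.mem_filter, mem_RR, mem_PP] at hx ⊢
    refine ⟨⟨?_, ?_, by linarith, ?_⟩, ?_⟩ <;> omega
  all_goals rintro ⟨u, g, a, d⟩ _; simp

theorem pc_pn (n : ℕ) : (∑ x ∈ RR n, if 0 < x.2.2.1 ∧ x.2.2.2 < 0 then (1 : ℤ) else 0)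
    = SS n (fun p c z q => if q < c ∧ c ≤ p + q ∧ z ≤ q ∧ (z + 2 * c + q) % 3 = 0
        then 1 else 0) := by
  unfold SS
  rw [← Finset.sum_filter, ← Finset.sum_filter]
  refine Finset.sum_nbij' (fun x => (x.1 - x.2.2.1, x.2.1, x.2.2.1, x.2.1 + x.2.2.2))
    (fun x => (x.1 + x.2.2.1, x.2.1, x.2.2.1, x.2.2.2 - x.2.1)) ?_ ?_ ?_ ?_ ?_
  · rintro ⟨u, g, a, d⟩ hx
    simp only [Finset.mem_filter, mem_RR, mem_PP] at hx ⊢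
    refine ⟨⟨?_, ?_, ?_, ?_, by linarith⟩, ?_⟩ <;> omega
  · rintro ⟨u, g, a, d⟩ hx
    simp only [Finset.mem_filter, mem_RR, mem_PP] at hx ⊢
    refine ⟨⟨?_, ?_, by linarith, ?_⟩, ?_⟩ <;> omega
  all_goals rintro ⟨u, g, a, d⟩ _; simp

theorem pc_np (n : ℕ) : (∑ x ∈ RR n, if x.2.2.1 < 0 ∧ 0 < x.2.2.2 then (1 : ℤ) else 0)
    = SS n (fun p c z q => if q < c ∧ c < p + q ∧ z < q ∧ (z + 2 * c + q) % 3 = 0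
        then 1 else 0) := by
  unfold SS
  rw [← Finset.sum_filter, ← Finset.sum_filter]
  refine Finset.sum_nbij' (fun x => (x.1 + x.2.2.1, x.2.1, -x.2.2.1, x.2.1 - x.2.2.2))
    (fun x => (x.1 + x.2.2.1, x.2.1, -x.2.2.1, x.2.1 - x.2.2.2)) ?_ ?_ ?_ ?_ ?_
  · rintro ⟨u, g, a, d⟩ hx
    simp only [Finset.mem_filter, mem_RR, mem_PP] at hx ⊢
    refine ⟨⟨?_, ?_, ?_, ?_, by linarith⟩, ?_⟩ <;> omega
  · rintro ⟨u, g, a, d⟩ hx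
    simp only [Finset.mem_filter, mem_RR, mem_PP] at hx ⊢
    refine ⟨⟨?_, ?_, by linarith, ?_⟩, ?_⟩ <;> omega
  all_goals rintro ⟨u, g, a, d⟩ _; simp

theorem pc_p0 (n : ℕ) (hn : ¬ 3 ∣ n) :
    (∑ x ∈ RR n, if 0 < x.2.2.1 ∧ x.2.2.2 = 0 then (1 : ℤ) else 0)
    = SS n (fun p c z q => if p = c + z + q ∧ c % 3 = 0 then 1 else 0) := by
  unfold SS
  rw [← Finset.sum_filter, ← Finset.sum_filter]
  refine Finset.sum_nbij' (fun x => (x.1 + x.2.1 - x.2.2.1, x.2.2.1, x.1 - x.2.2.1, x.2.1 - x.2.2.1))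
    (fun x => (x.2.1 + x.2.2.1, x.2.1 + x.2.2.2, x.2.1, 0)) ?_ ?_ ?_ ?_ ?_
  · rintro ⟨u, g, a, d⟩ hx
    simp only [Finset.mem_filter, mem_RR, mem_PP] at hx ⊢
    obtain ⟨⟨h1, h2, h3, h4, h5, h6, h7, h8⟩, h9, h10⟩ := hx
    subst h10
    have n1 : a ≠ u := by
      rintro rfl
      exact hn (by
        have : (3 : ℤ) ∣ n := by
          rw [← h3]; simp only [mul_zero, add_zero]
          exact Dvd.dvd.mul_right (by omega) _
        exact_mod_cast this)
    have n2 : a ≠ g := by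
      rintro rfl
      exact hn (by
        have : (3 : ℤ) ∣ n := by
          rw [← h3]; simp only [mul_zero, add_zero]
          exact Dvd.dvd.mul_left (by omega) _
        exact_mod_cast this)
    refine ⟨⟨?_, ?_, ?_, ?_, by linarith⟩, ?_⟩ <;> omega
  · rintro ⟨u, g, a, d⟩ hx
    simp only [Finset.mem_filter, mem_RR, mem_PP] at hx ⊢
    obtain ⟨⟨h1, h2, h3, h4, h5⟩, h6, h7⟩ := hx
    refine ⟨⟨?_, ?_, by subst h6; linarith, ?_⟩, ?_⟩ <;> first | omega | (simp; omega) | simp [h2]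
  · rintro ⟨u, g, a, d⟩ hx
    simp only [Finset.mem_filter, mem_RR, mem_PP] at hx ⊢
    simp [hx.2.2]
  · rintro ⟨u, g, a, d⟩ hx
    simp only [Finset.mem_filter, mem_RR, mem_PP] at hx ⊢
    simp [hx.2.1]; omega
  · intros; rfl

theorem pc_0n (n : ℕ) :
    (∑ x ∈ RR n, if x.2.2.1 = 0 ∧ x.2.2.2 < 0 then (1 : ℤ) else 0)
    = ∑ x ∈ RR n, if 0 < x.2.2.1 ∧ x.2.2.2 = 0 then (1 : ℤ) else 0 := by
  rw [← Finset.sum_filter, ← Finset.sum_filter]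
  refine Finset.sum_nbij' (fun x => (x.1, x.2.1, -x.2.2.2, -x.2.2.1))
    (fun x => (x.1, x.2.1, -x.2.2.2, -x.2.2.1)) ?_ ?_ ?_ ?_ ?_
  · rintro ⟨u, g, a, d⟩ hx
    simp only [Finset.mem_filter, mem_RR, mem_PP] at hx ⊢
    refine ⟨⟨?_, ?_, by linarith, ?_⟩, ?_⟩ <;> omega
  · rintro ⟨u, g, a, d⟩ hx
    simp only [Finset.mem_filter, mem_RR, mem_PP] at hx ⊢
    refine ⟨⟨?_, ?_, by linarith, ?_⟩, ?_⟩ <;> omega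
  all_goals rintro ⟨u, g, a, d⟩ _; simp

theorem pc_n0 (n : ℕ) :
    (∑ x ∈ RR n, if x.2.2.1 < 0 ∧ x.2.2.2 = 0 then (1 : ℤ) else 0)
    = ∑ x ∈ RR n, if x.2.2.1 = 0 ∧ 0 < x.2.2.2 then (1 : ℤ) else 0 := by
  rw [← Finset.sum_filter, ← Finset.sum_filter]
  refine Finset.sum_nbij' (fun x => (x.1, x.2.1, -x.2.2.2, -x.2.2.1))
    (fun x => (x.1, x.2.1, -x.2.2.2, -x.2.2.1)) ?_ ?_ ?_ ?_ ?_
  · rintro ⟨u, g, a, d⟩ hx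
    simp only [Finset.mem_filter, mem_RR, mem_PP] at hx ⊢
    refine ⟨⟨?_, ?_, by linarith, ?_⟩, ?_⟩ <;> omega
  · rintro ⟨u, g, a, d⟩ hx
    simp only [Finset.mem_filter, mem_RR, mem_PP] at hx ⊢
    refine ⟨⟨?_, ?_, by linarith, ?_⟩, ?_⟩ <;> omega
  all_goals rintro ⟨u, g, a, d⟩ _; simp

theorem pc_0p (n : ℕ) :
    (∑ x ∈ RR n, if x.2.2.1 = 0 ∧ 0 < x.2.2.2 then (1 : ℤ) else 0)
    = SS n (fun p c z q => if p = c + z + q ∧ c % 3 = 0 then 1 else 0) := by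
  unfold SS
  rw [← Finset.sum_filter, ← Finset.sum_filter]
  refine Finset.sum_nbij' (fun x => (x.1 + x.2.1 - x.2.2.2, x.2.2.2, x.1 - x.2.2.2, x.2.1 - x.2.2.2))
    (fun x => (x.2.1 + x.2.2.1, x.2.1 + x.2.2.2, 0, x.2.1)) ?_ ?_ ?_ ?_ ?_
  · rintro ⟨u, g, a, d⟩ hx
    simp only [Finset.mem_filter, mem_RR, mem_PP] at hx ⊢
    obtain ⟨⟨h1, h2, h3, h4, h5, h6, h7, h8⟩, h9, h10⟩ := hx
    subst h9
    refine ⟨⟨?_, ?_, ?_, ?_, by linarith⟩, ?_⟩ <;> omega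
  · rintro ⟨u, g, a, d⟩ hx
    simp only [Finset.mem_filter, mem_RR, mem_PP] at hx ⊢
    obtain ⟨⟨h1, h2, h3, h4, h5⟩, h6, h7⟩ := hx
    refine ⟨⟨?_, ?_, by subst h6; linarith, ?_⟩, ?_⟩ <;> first | omega | (simp; omega) | simp [h2]
  · rintro ⟨u, g, a, d⟩ hx
    simp only [Finset.mem_filter, mem_RR, mem_PP] at hx ⊢
    simp [hx.2.1]
  · rintro ⟨u, g, a, d⟩ hx
    simp only [Finset.mem_filter, mem_RR, mem_PP] at hx ⊢
    simp [hx.2.1]; omega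
  · intros; rfl

theorem pc_00 (n : ℕ) (hn : 0 < n) :
    (∑ x ∈ RR n, if x.2.2.1 = 0 ∧ x.2.2.2 = 0 then (1 : ℤ) else 0)
    = ∑ d ∈ n.divisors, 1 := by
  rw [← Finset.sum_filter]
  refine Finset.sum_nbij' (fun x => x.1.toNat)
    (fun d => ((d : ℤ), ((n / d : ℕ) : ℤ), 0, 0)) ?_ ?_ ?_ ?_ ?_
  · rintro ⟨u, g, a, d⟩ hx
    simp only [Finset.mem_filter, mem_RR] at hx ⊢
    obtain ⟨⟨h1, h2, h3, h4, h5, h6, h7, h8⟩, h9, h10⟩ := hx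
    subst h9 h10
    lift u to ℕ using h1.le
    refine Nat.mem_divisors.2 ⟨?_, hn.ne'⟩
    simp only [Int.toNat_natCast]
    have : (u : ℤ) ∣ n := ⟨g, by linarith⟩
    exact_mod_cast this
  · intro d hd
    have hd' := Nat.dvd_of_mem_divisors hd
    obtain ⟨k, rfl⟩ := hd'
    have hd0 : 0 < d := Nat.pos_of_mul_pos_right hn
    have hk0 : 0 < k := Nat.pos_of_mul_pos_left hn
    simp only [Finset.mem_filter, mem_RR]
    rw [Nat.mul_div_cancel_left _ hd0]
    refine ⟨⟨by omega, by omega, by push_cast; ring, by simp, ?_⟩, by simp⟩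
    omega
  · rintro ⟨u, g, a, d⟩ hx
    simp only [Finset.mem_filter, mem_RR] at hx ⊢
    obtain ⟨⟨h1, h2, h3, h4, h5, h6, h7, h8⟩, h9, h10⟩ := hx
    subst h9 h10
    lift u to ℕ using h1.le
    lift g to ℕ using h2.le
    have : n = u * g := by
      have : (n : ℤ) = u * g := by linarith
      exact_mod_cast this
    subst this
    rw [Int.toNat_natCast, Nat.mul_div_cancel_left _ (by omega)]
  · intro d hd
    simp
  · intros; rfl

theorem card_RR (n : ℕ) (hn : 0 < n) (h3 : ¬ 3 ∣ n) : ((RR n).card : ℤ) = n.divisors.card +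
    SS n (fun p c z q => 
      (if c < p + z ∧ c < p + q ∧ p ≤ c + z ∧ p ≤ c + q then 2 * d0 (p + c) else 0)
      + (if q < c ∧ c ≤ p + q ∧ z ≤ q then d0 (z + 2 * c + q) else 0)
      + (if q < c ∧ c < p + q ∧ z < q then d0 (z + 2 * c + q) else 0)
      + (if p = c + z + q then 4 * d0 c else 0)) := by
  have e : ((RR n).card : ℤ) = ∑ x ∈ RR n, ((if x.2.2.1 = 0 ∧ x.2.2.2 = 0 then (1 : ℤ) else 0)
      + (if 0 < x.2.2.1 ∧ 0 < x.2.2.2 then (1 : ℤ) else 0)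
      + (if x.2.2.1 < 0 ∧ x.2.2.2 < 0 then (1 : ℤ) else 0)
      + (if 0 < x.2.2.1 ∧ x.2.2.2 < 0 then (1 : ℤ) else 0)
      + (if x.2.2.1 < 0 ∧ 0 < x.2.2.2 then (1 : ℤ) else 0)
      + (if 0 < x.2.2.1 ∧ x.2.2.2 = 0 then (1 : ℤ) else 0)
      + (if x.2.2.1 = 0 ∧ x.2.2.2 < 0 then (1 : ℤ) else 0)
      + (if x.2.2.1 < 0 ∧ x.2.2.2 = 0 then (1 : ℤ) else 0)
      + (if x.2.2.1 = 0 ∧ 0 < x.2.2.2 then (1 : ℤ) else 0)) := by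
    rw [Finset.card_eq_sum_ones, Nat.cast_sum]
    refine Finset.sum_congr rfl ?_
    rintro ⟨u, g, a, d⟩ _
    have tri : ∀ x : ℤ, (x < 0 ∧ ¬ 0 < x ∧ ¬ x = 0) ∨ (¬ x < 0 ∧ ¬ 0 < x ∧ x = 0) ∨
        (¬ x < 0 ∧ 0 < x ∧ ¬ x = 0) := by intro x; omega
    rcases tri a with ⟨h1, h2, h3⟩ | ⟨h1, h2, h3⟩ | ⟨h1, h2, h3⟩ <;>
      rcases tri d with ⟨k1, k2, k3⟩ | ⟨k1, k2, k3⟩ | ⟨k1, k2, k3⟩ <;>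
      simp only [h1, h2, h3, k1, k2, k3] <;> simp
  rw [e]
  simp only [Finset.sum_add_distrib]
  rw [pc_00 n hn, pc_pp, pc_nn, pc_pn, pc_np, pc_0n, pc_n0, pc_0p, pc_p0 n h3]
  simp only [← SS_add, add_assoc]
  simp only [Finset.sum_const, nsmul_eq_mul, mul_one]
  congr 1
  apply SS_congr
  intro p c z q _ _ _ _ _
  rw [ite_d0, ite_d0, show (if c < p + z ∧ c < p + q ∧ p ≤ c + z ∧ p ≤ c + q then 2 * d0 (p + c) else 0)
      = 2 * (if c < p + z ∧ c < p + q ∧ p ≤ c + z ∧ p ≤ c + q then d0 (p + c) else 0) by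
      rw [mul_ite, mul_zero], ite_d0,
    show (if p = c + (z + q) then 4 * d0 c else 0) = 4 * (if p = c + (z + q) then d0 c else 0) by
      rw [mul_ite, mul_zero], ite_d0]
  simp only [and_assoc]
  ring


theorem SS_tie (n : ℕ) (hn : 0 < n) (F : ℤ → ℤ → ℤ) :
    SS n (fun p c _ q => if q = c then F p c else 0)
      = ∑ d ∈ n.divisors, ∑ p ∈ Finset.Ico 1 (n / d), F p d := by
  unfold SS
  rw [← Finset.sum_filter, Finset.sum_sigma']
  refine Finset.sum_nbij' (fun x => ⟨x.2.1.toNat, x.1.toNat⟩)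
    (fun y => ((y.2 : ℤ), (y.1 : ℤ), ((n / y.1 : ℕ) : ℤ) - y.2, (y.1 : ℤ))) ?_ ?_ ?_ ?_ ?_
  · rintro ⟨p, c, z, q⟩ hx
    simp only [Finset.mem_filter, mem_PP] at hx
    obtain ⟨⟨h1, h2, h3, h4, h5⟩, h6⟩ := hx
    subst h6
    lift p to ℕ using h1.le
    lift q to ℕ using h2.le
    lift z to ℕ using h3.le
    have e : n = q * (p + z) := by
      have : (n : ℤ) = q * (p + z) := by linarith
      exact_mod_cast this
    subst e
    simp only [Finset.mem_sigma, Nat.mem_divisors, Finset.mem_Ico, Int.toNat_natCast]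
    rw [Nat.mul_div_cancel_left _ (by omega)]
    exact ⟨⟨Dvd.intro _ rfl, hn.ne'⟩, by omega, by omega⟩
  · rintro ⟨d, p⟩ hy
    simp only [Finset.mem_sigma, Nat.mem_divisors, Finset.mem_Ico] at hy
    obtain ⟨⟨⟨k, rfl⟩, _⟩, h1, h2⟩ := hy
    have hd0 : 0 < d := Nat.pos_of_mul_pos_right hn
    rw [Nat.mul_div_cancel_left _ hd0] at h2
    simp only [Finset.mem_filter, mem_PP]
    rw [Nat.mul_div_cancel_left _ hd0]
    refine ⟨⟨by omega, by omega, by omega, by omega, ?_⟩, trivial⟩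
    push_cast; ring
  · rintro ⟨p, c, z, q⟩ hx
    simp only [Finset.mem_filter, mem_PP] at hx
    obtain ⟨⟨h1, h2, h3, h4, h5⟩, h6⟩ := hx
    subst h6
    lift p to ℕ using h1.le
    lift q to ℕ using h2.le
    lift z to ℕ using h3.le
    have e : n = q * (p + z) := by
      have : (n : ℤ) = q * (p + z) := by linarith
      exact_mod_cast this
    subst e
    simp only [Int.toNat_natCast]
    rw [Nat.mul_div_cancel_left _ (by omega)]
    simp
  · rintro ⟨d, p⟩ hy
    simp
  · rintro ⟨p, c, z, q⟩ hx
    simp only [Finset.mem_filter, mem_PP] at hx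
    obtain ⟨⟨h1, h2, h3, h4, h5⟩, h6⟩ := hx
    simp only [Int.toNat_of_nonneg h1.le, Int.toNat_of_nonneg h2.le]

theorem SS_E1 (n : ℕ) (hn : 0 < n) :
    SS n (fun p c z q => if p = c + z + q then 1 else 0)
      = ∑ d ∈ n.divisors, ∑ _p ∈ Finset.Ico 1 (min d (n / d)), 1 := by
  unfold SS
  rw [← Finset.sum_filter, Finset.sum_sigma']
  refine Finset.sum_nbij' (fun x => ⟨(x.2.1 + x.2.2.1).toNat, x.2.1.toNat⟩)
    (fun y => ((y.1 : ℤ) + ((n / y.1 : ℕ) : ℤ) - y.2, (y.2 : ℤ), (y.1 : ℤ) - y.2,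
      ((n / y.1 : ℕ) : ℤ) - y.2)) ?_ ?_ ?_ ?_ ?_
  · rintro ⟨p, c, z, q⟩ hx
    simp only [Finset.mem_filter, mem_PP] at hx
    obtain ⟨⟨h1, h2, h3, h4, h5⟩, h6⟩ := hx
    lift c to ℕ using h2.le
    lift q to ℕ using h4.le
    lift z to ℕ using h3.le
    have e : n = (c + z) * (c + q) := by
      have : (n : ℤ) = (c + z) * (c + q) := by subst h6; linarith
      exact_mod_cast this
    subst e
    simp only [Finset.mem_sigma, Nat.mem_divisors, Finset.mem_Ico, Int.toNat_natCast,
      ← Nat.cast_add]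
    rw [Nat.mul_div_cancel_left _ (by omega)]
    exact ⟨⟨Dvd.intro _ rfl, hn.ne'⟩, by omega, by omega⟩
  · rintro ⟨d, p⟩ hy
    simp only [Finset.mem_sigma, Nat.mem_divisors, Finset.mem_Ico] at hy
    obtain ⟨⟨⟨k, rfl⟩, _⟩, h1, h2⟩ := hy
    have hd0 : 0 < d := Nat.pos_of_mul_pos_right hn
    rw [Nat.mul_div_cancel_left _ hd0] at h2
    simp only [Finset.mem_filter, mem_PP]
    rw [Nat.mul_div_cancel_left _ hd0]
    refine ⟨⟨by omega, by omega, by omega, by omega, ?_⟩, by ring⟩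
    push_cast; ring
  · rintro ⟨p, c, z, q⟩ hx
    simp only [Finset.mem_filter, mem_PP] at hx
    obtain ⟨⟨h1, h2, h3, h4, h5⟩, h6⟩ := hx
    lift c to ℕ using h2.le
    lift q to ℕ using h4.le
    lift z to ℕ using h3.le
    have e : n = (c + z) * (c + q) := by
      have : (n : ℤ) = (c + z) * (c + q) := by subst h6; linarith
      exact_mod_cast this
    subst e
    simp only [Int.toNat_natCast, ← Nat.cast_add]
    rw [Nat.mul_div_cancel_left _ (by omega)]
    simp only [Prod.mk.injEq]
    push_cast
    refine ⟨?_, trivial, ?_, ?_⟩ <;> omega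
  · rintro ⟨d, p⟩ hy
    simp
  · intros; rfl

theorem dd_val (r m : ℕ) : dd r m = if m % 3 = r then 1 else 0 := by
  unfold dd
  by_cases h' : m % 3 = r
  · simp [h']
  · have : Nat.beq (m % 3) r = false := by
      cases hb : Nat.beq (m % 3) r
      · rfl
      · exact absurd (Nat.eq_of_beq_eq_true hb) h'
    simp [h', this]

theorem dd_rr (x : ℤ) (m : ℕ) (h : x % 3 = (m : ℤ) % 3) : dd 0 m = d0 x := by
  rw [dd_val]; unfold d0
  split_ifs <;> omega

theorem cT_eq {n : ℕ} {p c z q : ℤ} (h : p * c + z * q = n) :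
    cT p c z q (rr p) (rr c) (rr z) (rr q) = 
      ((if c < p + z ∧ c < p + q ∧ p ≤ c + z ∧ p ≤ c + q then 2 * d0 (p + c) else 0)
      + (if q < c ∧ c ≤ p + q ∧ z ≤ q then d0 (z + 2 * c + q) else 0)
      + (if q < c ∧ c < p + q ∧ z < q then d0 (z + 2 * c + q) else 0)
      + (if p = c + z + q then 4 * d0 c else 0))
      + 2 * dd 2 n * (if p = c + z + q then 1 else 0)
      + (if q = c then tieT (rr p) (rr c) n else 0) := by
  have hm := rr_mod h
  have hdd : ∀ r, dd r (rr p * rr c + rr z * rr q) = dd r n := by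
    intro r; simp only [dd_val, hm]
  unfold cT
  rw [dd_rr (p + c) (rr p + rr c) (by unfold rr; omega),
    dd_rr (z + 2 * c + q) (rr z + 2 * rr c + rr q) (by unfold rr; omega),
    dd_rr c (rr c) (by unfold rr; omega)]
  simp only [cm_eq_zero, cm_lt_two, cm_eq_one, tieT, hdd]
  by_cases h1 : p = c + z + q
  · simp only [h1, if_true]; ring
  · simp only [h1, if_false]; ring

theorem card_RR_eq (n : ℕ) (hn : 0 < n) (h3 : ¬ 3 ∣ n) : ((RR n).card : ℤ) = n.divisors.card
    - 2 * dd 2 n * (∑ d ∈ n.divisors, ∑ _p ∈ Finset.Ico 1 (min d (n / d)), 1)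
    - ∑ d ∈ n.divisors, ∑ p ∈ Finset.Ico 1 (n / d), tieT p d n := by
  have h0 := SS_cT n h3
  rw [SS_congr (fun p c z q _ _ _ _ h => cT_eq h), SS_add, SS_add,
    SS_tie n hn (fun p c => tieT (rr p) (rr c) n)] at h0
  rw [card_RR n hn h3]
  have e : SS n (fun p c z q => 2 * dd 2 n * (if p = c + z + q then 1 else 0))
      = 2 * dd 2 n * SS n (fun p c z q => if p = c + z + q then 1 else 0) := by
    simp only [SS, Finset.mul_sum]
  rw [e, SS_E1 n hn] at h0
  have e2 : ∀ d p : ℕ, tieT (rr (p : ℤ)) (rr (d : ℤ)) n = tieT p d n := by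
    intro d p
    have : ∀ x : ℕ, rr (x : ℤ) % 3 = x % 3 := by intro x; unfold rr; omega
    simp only [tieT, dd_val, this]
  simp only [e2] at h0
  linarith

theorem sum_ico_a (k : ℕ) : ∑ p ∈ Finset.Ico 1 (3 * k + 2), (dd 1 p - dd 0 p) = 1 := by
  induction k with
  | zero => decide
  | succ k ih =>
    rw [show 3 * (k + 1) + 2 = 3 * k + 2 + 1 + 1 + 1 by ring,
      Finset.sum_Ico_succ_top (by omega), Finset.sum_Ico_succ_top (by omega),
      Finset.sum_Ico_succ_top (by omega), ih]
    simp only [dd_val]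
    rw [show (3 * k + 2) % 3 = 2 by omega, show (3 * k + 2 + 1) % 3 = 0 by omega,
      show (3 * k + 2 + 1 + 1) % 3 = 1 by omega]
    norm_num

theorem sum_ico_b (k : ℕ) : ∑ p ∈ Finset.Ico 1 (3 * k + 1), (dd 1 p - dd 2 p) = 0 := by
  induction k with
  | zero => simp
  | succ k ih =>
    rw [show 3 * (k + 1) + 1 = 3 * k + 1 + 1 + 1 + 1 by ring,
      Finset.sum_Ico_succ_top (by omega), Finset.sum_Ico_succ_top (by omega),
      Finset.sum_Ico_succ_top (by omega), ih]
    simp only [dd_val]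
    rw [show (3 * k + 1) % 3 = 1 by omega, show (3 * k + 1 + 1) % 3 = 2 by omega,
      show (3 * k + 1 + 1 + 1) % 3 = 0 by omega]
    norm_num

theorem sum_div_flip (n : ℕ) (F : ℕ → ℤ) : ∑ d ∈ n.divisors, F (n / d) = ∑ d ∈ n.divisors, F d :=
  Nat.sum_div_divisors n F

theorem sum_pred (n : ℕ) : ∑ d ∈ n.divisors, (((n / d : ℕ) : ℤ) - 1) =
    (∑ d ∈ n.divisors, (d : ℤ)) - n.divisors.card := by
  rw [sum_div_flip n (fun m => (m : ℤ) - 1), Finset.sum_sub_distrib]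
  simp

theorem card_RR_one (n : ℕ) (h1 : n % 3 = 1) : ((RR n).card : ℤ) = ∑ d ∈ n.divisors, (d : ℤ) := by
  have hn : 0 < n := by omega
  rw [card_RR_eq n hn (by omega)]
  have e : ∑ d ∈ n.divisors, ∑ p ∈ Finset.Ico 1 (n / d), tieT p d n
      = - ∑ d ∈ n.divisors, (((n / d : ℕ) : ℤ) - 1) := by
    rw [← Finset.sum_neg_distrib]
    refine Finset.sum_congr rfl fun d hd => ?_
    have hd' : 0 < n / d := Nat.div_pos (Nat.divisor_le hd) (Nat.pos_of_mem_divisors hd)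
    rw [Finset.sum_congr rfl (g := fun _ => (-1 : ℤ)) (by
      intro p _; simp [tieT, dd_val, h1])]
    simp
    omega
  rw [e, sum_pred]
  simp [dd_val, h1]

theorem card_RR_two (n : ℕ) (h2 : n % 3 = 2) : ((RR n).card : ℤ) =
    2 * (∑ d ∈ n.divisors, (d : ℤ)) - 4 * ∑ d ∈ n.divisors.filter (fun d => d ^ 2 < n), (d : ℤ) := by
  have hn : 0 < n := by omega
  rw [card_RR_eq n hn (by omega)]
  have hmod : ∀ d ∈ n.divisors, (d % 3 = 1 ∧ n / d % 3 = 2) ∨ (d % 3 = 2 ∧ n / d % 3 = 1) := by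
    intro d hd
    obtain ⟨k, hk⟩ := Nat.dvd_of_mem_divisors hd
    have hd0 := Nat.pos_of_mem_divisors hd
    have : n / d = k := by rw [hk]; exact Nat.mul_div_cancel_left _ hd0
    rw [this]
    have h := Nat.mul_mod d k 3
    rw [← hk, h2] at h
    have a1 : d % 3 < 3 := Nat.mod_lt _ (by norm_num)
    have a2 : k % 3 < 3 := Nat.mod_lt _ (by norm_num)
    generalize d % 3 = x at *
    generalize k % 3 = y at *
    interval_cases x <;> interval_cases y <;> omega
  have e : ∑ d ∈ n.divisors, ∑ p ∈ Finset.Ico 1 (n / d), tieT p d n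
      = - 2 * (∑ d ∈ n.divisors, (((n / d : ℕ) : ℤ) - 1)) + ∑ d ∈ n.divisors, 2 * dd 1 d := by
    rw [Finset.mul_sum, ← Finset.sum_add_distrib]
    refine Finset.sum_congr rfl fun d hd => ?_
    have hd' : 0 < n / d := Nat.div_pos (Nat.divisor_le hd) (Nat.pos_of_mem_divisors hd)
    rcases hmod d hd with ⟨h, h'⟩ | ⟨h, h'⟩
    · rw [Finset.sum_congr rfl (g := fun p => (-2 : ℤ) + 2 * (dd 1 p - dd 0 p)) (by
        intro p _; simp [tieT, dd_val, h2, h]; ring)]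
      rw [Finset.sum_add_distrib, ← Finset.mul_sum, 
        show n / d = 3 * (n / d / 3) + 2 by omega, sum_ico_a]
      simp [dd_val, h]
      ring
    · rw [Finset.sum_congr rfl (g := fun p => (-2 : ℤ) + (-2) * (dd 1 p - dd 2 p)) (by
        intro p _; simp [tieT, dd_val, h2, h]; ring)]
      rw [Finset.sum_add_distrib, ← Finset.mul_sum, 
        show n / d = 3 * (n / d / 3) + 1 by omega, sum_ico_b]
      simp [dd_val, h]
      ring
  have e1 : ∑ d ∈ n.divisors, 2 * dd 1 d = n.divisors.card := by
    have f := sum_div_flip n (fun d => dd 1 d)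
    have g : ∑ d ∈ n.divisors, dd 1 (n / d) = ∑ d ∈ n.divisors, (1 - dd 1 d) := by
      refine Finset.sum_congr rfl fun d hd => ?_
      rcases hmod d hd with ⟨h, h'⟩ | ⟨h, h'⟩ <;> simp [dd_val, h, h']
    rw [g, Finset.sum_sub_distrib] at f
    rw [← Finset.mul_sum]
    simp at f ⊢
    linarith
  have e2 : (∑ d ∈ n.divisors, ∑ _p ∈ Finset.Ico 1 (min d (n / d)), (1 : ℤ))
      = 2 * (∑ d ∈ n.divisors.filter (fun d => d ^ 2 < n), (d : ℤ)) - n.divisors.card := by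
    have g : ∀ d ∈ n.divisors, (∑ _p ∈ Finset.Ico 1 (min d (n / d)), (1 : ℤ)) =
        ((if d ^ 2 < n then (d : ℤ) else 0)
          + (if (n / d) ^ 2 < n then ((n / d : ℕ) : ℤ) else 0)) - 1 := by
      intro d hd
      have hd0 := Nat.pos_of_mem_divisors hd
      have hd' : 0 < n / d := Nat.div_pos (Nat.divisor_le hd) (Nat.pos_of_mem_divisors hd)
      have hk : d * (n / d) = n := Nat.mul_div_cancel' (Nat.dvd_of_mem_divisors hd)
      have hm := hmod d hd
      generalize n / d = k at *
      have hne : d ≠ k := by rintro rfl; omega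
      rcases lt_or_gt_of_ne hne with h | h
      · have i1 : d ^ 2 < n := by nlinarith
        have i2 : ¬ k ^ 2 < n := by nlinarith
        simp [i1, i2, min_eq_left h.le]; omega
      · have i1 : ¬ d ^ 2 < n := by nlinarith
        have i2 : k ^ 2 < n := by nlinarith
        simp [i1, i2, min_eq_right h.le]; omega
    rw [Finset.sum_congr rfl g, Finset.sum_sub_distrib, Finset.sum_add_distrib,
      sum_div_flip n (fun k => if k ^ 2 < n then (k : ℤ) else 0), Finset.sum_filter]
    simp
    ring
  rw [e, e1, e2, sum_pred]
  simp [dd_val, h2]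
  ring


/-- reducedness -/
def Red (Q : ℤ × ℤ × ℤ) : Prop :=
  0 < Q.1 ∧ 0 < Q.2.2 ∧ Q.2.1 ≤ Q.1 ∧ Q.2.1 ≤ Q.2.2 ∧ -Q.1 < Q.2.1 ∧ -Q.2.2 < Q.2.1

instance (Q : ℤ × ℤ × ℤ) : Decidable (Red Q) := by unfold Red; infer_instance

theorem formAct_mk (γ : Matrix.SpecialLinearGroup (Fin 2) ℤ) (a b c : ℤ) :
    formAct γ (a, b, c) =
      (a * γ.1 0 0 ^ 2 + b * γ.1 0 0 * γ.1 1 0 + c * γ.1 1 0 ^ 2,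
       2 * a * γ.1 0 0 * γ.1 0 1 + b * (γ.1 0 0 * γ.1 1 1 + γ.1 1 0 * γ.1 0 1)
        + 2 * c * γ.1 1 0 * γ.1 1 1,
       a * γ.1 0 1 ^ 2 + b * γ.1 0 1 * γ.1 1 1 + c * γ.1 1 1 ^ 2) := by
  simp only [formAct, formEval, Prod.mk.injEq]
  refine ⟨trivial, ?_, trivial⟩
  ring

theorem formAct_mul (γ δ : Matrix.SpecialLinearGroup (Fin 2) ℤ) (Q : ℤ × ℤ × ℤ) :
    formAct (γ * δ) Q = formAct δ (formAct γ Q) := by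
  obtain ⟨a, b, c⟩ := Q
  rw [formAct_mk, formAct_mk, formAct_mk]
  simp only [Matrix.SpecialLinearGroup.coe_mul, Matrix.mul_apply, Fin.sum_univ_two, Prod.mk.injEq]
  refine ⟨?_, ?_, ?_⟩ <;> ring

theorem formAct_one (Q : ℤ × ℤ × ℤ) : formAct 1 Q = Q := by
  obtain ⟨a, b, c⟩ := Q
  rw [formAct_mk]
  simp

theorem det_eq (γ : Matrix.SpecialLinearGroup (Fin 2) ℤ) :
    γ.1 0 0 * γ.1 1 1 - γ.1 0 1 * γ.1 1 0 = 1 := by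
  have := γ.2
  rwa [Matrix.det_fin_two] at this

theorem formDisc_act (γ : Matrix.SpecialLinearGroup (Fin 2) ℤ) (Q : ℤ × ℤ × ℤ) :
    formDisc (formAct γ Q) = formDisc Q := by
  obtain ⟨a, b, c⟩ := Q
  rw [formAct_mk]
  have h := det_eq γ
  simp only [formDisc]
  generalize γ.1 0 0 = x at *
  generalize γ.1 0 1 = z at *
  generalize γ.1 1 0 = y at *
  generalize γ.1 1 1 = w at *
  have : (b ^ 2 - 4 * a * c) * (x * w - z * y) ^ 2 = b ^ 2 - 4 * a * c := by rw [h]; ring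
  rw [← this]; ring

theorem posDef_act (γ : Matrix.SpecialLinearGroup (Fin 2) ℤ) (Q : ℤ × ℤ × ℤ) (hQ : IsPosDef Q) :
    IsPosDef (formAct γ Q) := by
  refine ⟨?_, by rw [formDisc_act]; exact hQ.2⟩
  obtain ⟨a, b, c⟩ := Q
  obtain ⟨h1, h2⟩ := hQ
  rw [formAct_mk]
  have h := det_eq γ
  simp only [formDisc] at *
  generalize γ.1 0 0 = x at *
  generalize γ.1 0 1 = z at *
  generalize γ.1 1 0 = y at *
  generalize γ.1 1 1 = w at *
  have e : 4 * a * (a * x ^ 2 + b * x * y + c * y ^ 2)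
    = (2 * a * x + b * y) ^ 2 + (4 * a * c - b ^ 2) * y ^ 2 := by ring
  by_contra hcon
  have hle : 4 * a * (a * x ^ 2 + b * x * y + c * y ^ 2) ≤ 0 := by nlinarith
  rw [e] at hle
  have hN : 0 < 4 * a * c - b ^ 2 := by linarith
  have hy : y = 0 := by
    by_contra hy
    have : 0 < y ^ 2 := by positivity
    nlinarith [sq_nonneg (2 * a * x + b * y), mul_pos hN this]
  subst hy
  have hx : x = 0 := by
    by_contra hx
    have : 0 < (2 * a * x) ^ 2 := by positivity
    nlinarith
  subst hx
  simp at h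

theorem Q_ge {a b c x y : ℤ} (ha : 0 < a) (h1 : b ≤ a) (h2 : -a < b) (h3 : a ≤ c) (hy : y ≠ 0) :
    c ≤ a * x ^ 2 + b * x * y + c * y ^ 2 := by
  have hy2 : 1 ≤ y ^ 2 := by
    have : 0 < y ^ 2 := by positivity
    omega
  have e1 : a * (x ^ 2 - |x * y| + y ^ 2) + (c - a) * y ^ 2 ≤ a * x ^ 2 + b * x * y + c * y ^ 2 := by
    rcases abs_cases (x * y) with ⟨h, h'⟩ | ⟨h, h'⟩ <;> rw [h] <;> nlinarith
  have e2 : 1 ≤ x ^ 2 - |x * y| + y ^ 2 := by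
    rcases abs_cases (x * y) with ⟨h, h'⟩ | ⟨h, h'⟩ <;> rw [h]
    · nlinarith [sq_nonneg (2 * x - y)]
    · nlinarith [sq_nonneg (2 * x + y)]
  nlinarith

theorem Q_ge3 {a b c x y : ℤ} (ha : 0 < a) (h1 : b ≤ a) (h2 : -a < b) (h3 : a ≤ c) (hy : 4 ≤ y ^ 2) :
    3 * c ≤ a * x ^ 2 + b * x * y + c * y ^ 2 := by
  have e1 : a * (x ^ 2 - |x * y| + y ^ 2) + (c - a) * y ^ 2 ≤ a * x ^ 2 + b * x * y + c * y ^ 2 := by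
    rcases abs_cases (x * y) with ⟨h, h'⟩ | ⟨h, h'⟩ <;> rw [h] <;> nlinarith
  have e2 : 3 ≤ x ^ 2 - |x * y| + y ^ 2 := by
    rcases abs_cases (x * y) with ⟨h, h'⟩ | ⟨h, h'⟩ <;> rw [h]
    · nlinarith [sq_nonneg (2 * x - y)]
    · nlinarith [sq_nonneg (2 * x + y)]
  nlinarith

theorem sq_cases {y : ℤ} (hy : y ≠ 0) : 4 ≤ y ^ 2 ∨ y = 1 ∨ y = -1 := by
  by_cases h : 2 ≤ y ∨ y ≤ -2
  · left; rcases h with h | h <;> nlinarith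
  · right; omega

theorem shift_unique {a b k : ℤ} (ha : 0 < a) (h1 : b ≤ a) (h2 : -a < b) (h3 : 2 * a * k + b ≤ a)
    (h4 : -a < 2 * a * k + b) : k = 0 := by
  have : k < 1 := by nlinarith
  have : -1 < k := by nlinarith
  omega

theorem red_unique {a b c x y z w : ℤ} (ha : 0 < a) (h1 : b ≤ a) (h2 : -a < b) (h3 : a ≤ c)
    (hN : ∀ k : ℤ, 4 * a * c - b ^ 2 ≠ 3 * k ^ 2) (hd : x * w - z * y = 1)
    (hR : Red (a * x ^ 2 + b * x * y + c * y ^ 2,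
      2 * a * x * z + b * (x * w + y * z) + 2 * c * y * w, a * z ^ 2 + b * z * w + c * w ^ 2)) :
    (x = 1 ∧ y = 0 ∧ z = 0 ∧ w = 1) ∨ (x = -1 ∧ y = 0 ∧ z = 0 ∧ w = -1) ∨
    (x = (if b = a then 1 else 0) ∧ y = -1 ∧ z = 1 ∧ w = 0) ∨
    (x = -(if b = a then 1 else 0) ∧ y = 1 ∧ z = -1 ∧ w = 0) := by
  obtain ⟨r1, r2, r3, r4, r5, r6⟩ := hR
  simp only at r1 r2 r3 r4 r5 r6
  by_cases hy : y = 0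
  · subst hy
    simp only [mul_zero, sub_zero] at hd
    have hxw : (x = 1 ∧ w = 1) ∨ (x = -1 ∧ w = -1) := Int.eq_one_or_neg_one_of_mul_eq_one' hd
    rcases hxw with ⟨rfl, rfl⟩ | ⟨rfl, rfl⟩
    · have := shift_unique (k := z) ha h1 h2 (by linarith) (by linarith)
      omega
    · have := shift_unique (k := -z) ha h1 h2 (by linarith) (by linarith)
      omega
  by_cases hw : w = 0
  · subst hw
    have hzy : z * (-y) = 1 := by linarith
    have hxw : (z = 1 ∧ -y = 1) ∨ (z = -1 ∧ -y = -1) := Int.eq_one_or_neg_one_of_mul_eq_one' hzy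
    rcases hxw with ⟨rfl, hy'⟩ | ⟨rfl, hy'⟩
    · have hy'' : y = -1 := by omega
      subst hy''
      by_cases hb : b = a
      · have := shift_unique (k := x - 1) ha h1 h2 (by subst hb; linarith) (by subst hb; linarith)
        exact Or.inr (Or.inr (Or.inl ⟨by rw [if_pos hb]; omega, rfl, rfl, rfl⟩))
      · have := shift_unique (b := -b) (k := x) ha (by omega) (by omega) (by linarith) (by linarith)
        exact Or.inr (Or.inr (Or.inl ⟨by rw [if_neg hb]; omega, rfl, rfl, rfl⟩))
    · have hy'' : y = 1 := by omega
      subst hy''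
      by_cases hb : b = a
      · have := shift_unique (k := -x - 1) ha h1 h2 (by subst hb; linarith) (by subst hb; linarith)
        exact Or.inr (Or.inr (Or.inr ⟨by rw [if_pos hb]; omega, rfl, rfl, rfl⟩))
      · have := shift_unique (b := -b) (k := -x) ha (by omega) (by omega) (by linarith) (by linarith)
        exact Or.inr (Or.inr (Or.inr ⟨by rw [if_neg hb]; omega, rfl, rfl, rfl⟩))
  exfalso
  have g1 := Q_ge (x := x) ha h1 h2 h3 hy
  have g2 := Q_ge (x := z) ha h1 h2 h3 hw
  have hsq := sq_le_of_bounds r1 r2 r3 r4 r5.le r6.le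
  have hdisc : 4 * (a * x ^ 2 + b * x * y + c * y ^ 2) * (a * z ^ 2 + b * z * w + c * w ^ 2)
      - (2 * a * x * z + b * (x * w + y * z) + 2 * c * y * w) ^ 2 = 4 * a * c - b ^ 2 := by
    have : (4 * a * c - b ^ 2) * (x * w - z * y) ^ 2 = 4 * a * c - b ^ 2 := by rw [hd]; ring
    rw [← this]; ring
  have hdiff : a * (x - z) ^ 2 + b * (x - z) * (y - w) + c * (y - w) ^ 2
      = (a * x ^ 2 + b * x * y + c * y ^ 2) + (a * z ^ 2 + b * z * w + c * w ^ 2)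
        - (2 * a * x * z + b * (x * w + y * z) + 2 * c * y * w) := by ring
  have hsum : a * (x + z) ^ 2 + b * (x + z) * (y + w) + c * (y + w) ^ 2
      = (a * x ^ 2 + b * x * y + c * y ^ 2) + (a * z ^ 2 + b * z * w + c * w ^ 2)
        + (2 * a * x * z + b * (x * w + y * z) + 2 * c * y * w) := by ring
  have g1' := Q_ge3 (x := x) (y := y) ha h1 h2 h3
  have g2' := Q_ge3 (x := z) (y := w) ha h1 h2 h3
  generalize a * x ^ 2 + b * x * y + c * y ^ 2 = a' at *
  generalize a * z ^ 2 + b * z * w + c * w ^ 2 = c' at *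
  generalize 2 * a * x * z + b * (x * w + y * z) + 2 * c * y * w = b' at *
  have hc : 0 < c := by omega
  have key : 3 * (a' * c') ≤ 4 * (a * c) := by nlinarith [sq_nonneg b]
  have key2 : a * c ≤ c * c := by nlinarith
  have hcc : 0 < c * c := by positivity
  rcases sq_cases hy with h | h
  · have := g1' h
    have : (3 * c) * c ≤ a' * c' := mul_le_mul this g2 hc.le (by omega)
    nlinarith
  rcases sq_cases hw with h' | h'
  · have := g2' h'
    have : c * (3 * c) ≤ a' * c' := mul_le_mul g1 this (by omega) (by omega)
    nlinarith
  have fin1 : ∀ s : ℤ, s ^ 2 = 1 → a * s ^ 2 = a' + c' - b' → False := by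
    intro s hs h
    rw [hs] at h
    have e1 : a' = a := by omega
    have e2 : c' = a := by omega
    have e3 : b' = a := by omega
    subst e1
    rw [e2, e3] at hdisc
    exact hN a' (by linarith)
  have fin2 : ∀ s : ℤ, s ^ 2 = 1 → a * s ^ 2 = a' + c' + b' → False := by
    intro s hs h
    rw [hs] at h
    omega
  rcases h with rfl | rfl <;> rcases h' with rfl | rfl
  · exact fin1 (x - z) (by rw [show x - z = 1 by linarith]; norm_num) (by rw [← hdiff]; ring)
  · exact fin2 (x + z) (by rw [show x + z = -1 by linarith]; norm_num) (by rw [← hsum]; ring)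
  · exact fin2 (x + z) (by rw [show x + z = 1 by linarith]; norm_num) (by rw [← hsum]; ring)
  · exact fin1 (x - z) (by rw [show x - z = -1 by linarith]; norm_num) (by rw [← hdiff]; ring)


/-- the special linear group -/
abbrev GG := Matrix.SpecialLinearGroup (Fin 2) ℤ

theorem GG_ext {γ δ : GG} (h1 : γ.1 0 0 = δ.1 0 0) (h2 : γ.1 0 1 = δ.1 0 1)
    (h3 : γ.1 1 0 = δ.1 1 0) (h4 : γ.1 1 1 = δ.1 1 1) : γ = δ := by
  apply Matrix.SpecialLinearGroup.ext
  intro i j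
  fin_cases i <;> fin_cases j <;> assumption

/-- constructor -/
def mkG (x z y w : ℤ) (h : x * w - z * y = 1) : GG :=
  ⟨!![x, z; y, w], by rw [Matrix.det_fin_two]; simpa using h⟩

theorem card_red (a b c : ℤ) (ha : 0 < a) (h1 : b ≤ a) (h2 : -a < b) (h3 : a ≤ c)
    (hN : ∀ k : ℤ, 4 * a * c - b ^ 2 ≠ 3 * k ^ 2) :
    Nat.card {γ : GG // Red (formAct γ (a, b, c))} = 4 := by
  have hset : ∃ S : Finset GG, S.card = 4 ∧ ∀ γ : GG, Red (formAct γ (a, b, c)) ↔ γ ∈ S := by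
    by_cases hb : b = a
    · refine ⟨{mkG 1 0 0 1 (by norm_num), mkG (-1) 0 0 (-1) (by norm_num),
        mkG 1 1 (-1) 0 (by norm_num), mkG (-1) (-1) 1 0 (by norm_num)}, by decide, ?_⟩
      intro γ
      constructor
      · intro hR
        rw [formAct_mk] at hR
        have := red_unique ha h1 h2 h3 hN (det_eq γ) hR
        rw [if_pos hb] at this
        simp only [Finset.mem_insert, Finset.mem_singleton]
        rcases this with ⟨e1, e2, e3, e4⟩ | ⟨e1, e2, e3, e4⟩ | ⟨e1, e2, e3, e4⟩ | ⟨e1, e2, e3, e4⟩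
        · exact Or.inl (GG_ext e1 e3 e2 e4)
        · exact Or.inr (Or.inl (GG_ext e1 e3 e2 e4))
        · exact Or.inr (Or.inr (Or.inl (GG_ext e1 e3 e2 e4)))
        · exact Or.inr (Or.inr (Or.inr (GG_ext e1 e3 e2 e4)))
      · simp only [Finset.mem_insert, Finset.mem_singleton]
        rintro (rfl | rfl | rfl | rfl) <;> rw [formAct_mk] <;> simp [mkG, Red] <;> omega
    · refine ⟨{mkG 1 0 0 1 (by norm_num), mkG (-1) 0 0 (-1) (by norm_num),
        mkG 0 1 (-1) 0 (by norm_num), mkG 0 (-1) 1 0 (by norm_num)}, by decide, ?_⟩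
      intro γ
      constructor
      · intro hR
        rw [formAct_mk] at hR
        have := red_unique ha h1 h2 h3 hN (det_eq γ) hR
        rw [if_neg hb, neg_zero] at this
        simp only [Finset.mem_insert, Finset.mem_singleton]
        rcases this with ⟨e1, e2, e3, e4⟩ | ⟨e1, e2, e3, e4⟩ | ⟨e1, e2, e3, e4⟩ | ⟨e1, e2, e3, e4⟩
        · exact Or.inl (GG_ext e1 e3 e2 e4)
        · exact Or.inr (Or.inl (GG_ext e1 e3 e2 e4))
        · exact Or.inr (Or.inr (Or.inl (GG_ext e1 e3 e2 e4)))
        · exact Or.inr (Or.inr (Or.inr (GG_ext e1 e3 e2 e4)))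
      · simp only [Finset.mem_insert, Finset.mem_singleton]
        rintro (rfl | rfl | rfl | rfl) <;> rw [formAct_mk] <;> simp [mkG, Red] <;> omega
  obtain ⟨S, hS, hiff⟩ := hset
  rw [← hS, ← Fintype.card_coe S, ← Nat.card_eq_fintype_card]
  exact Nat.card_congr (Equiv.subtypeEquivRight hiff)

theorem exists_red (Q : ℤ × ℤ × ℤ) (hQ : IsPosDef Q) : ∃ γ : GG, ∃ a b c : ℤ,
    formAct γ Q = (a, b, c) ∧ 0 < a ∧ b ≤ a ∧ -a < b ∧ a ≤ c := by
  have hne : ∃ m : ℕ, ∃ γ : GG, (formAct γ Q).1 = m := by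
    refine ⟨(formAct 1 Q).1.toNat, 1, ?_⟩
    rw [Int.toNat_of_nonneg (posDef_act 1 Q hQ).1.le]
  classical
  obtain ⟨γ, hγ⟩ := Nat.find_spec hne
  have hmin : ∀ δ : GG, (formAct γ Q).1 ≤ (formAct δ Q).1 := by
    intro δ
    have := Nat.find_min' hne (m := (formAct δ Q).1.toNat) ⟨δ, by
      rw [Int.toNat_of_nonneg (posDef_act δ Q hQ).1.le]⟩
    have hp := (posDef_act δ Q hQ).1
    omega
  have hpos := (posDef_act γ Q hQ).1
  clear hγ
  obtain ⟨a, b, c, h⟩ : ∃ a b c, formAct γ Q = (a, b, c) := ⟨_, _, _, rfl⟩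
  rw [h] at hpos
  simp only [h] at hmin
  set m := (b + a - 1) / (2 * a) with hm
  obtain ⟨c', hT⟩ : ∃ c', formAct (γ * mkG 1 (-m) 0 1 (by ring)) Q = (a, b - 2 * a * m, c') := by
    refine ⟨a * m ^ 2 - b * m + c, ?_⟩
    rw [formAct_mul, h, formAct_mk]
    simp [mkG]
    refine ⟨?_, ?_⟩ <;> ring
  have hS := hmin (γ * mkG 1 (-m) 0 1 (by ring) * mkG 0 (-1) 1 0 (by ring))
  rw [formAct_mul, hT, formAct_mk] at hS
  simp [mkG] at hS
  have d1 := Int.emod_nonneg (b + a - 1) (show 2 * a ≠ 0 by omega)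
  have d2 := Int.emod_lt_of_pos (b + a - 1) (show 0 < 2 * a by omega)
  have d3 := Int.mul_ediv_add_emod (b + a - 1) (2 * a)
  rw [← hm] at d3
  exact ⟨_, _, _, _, hT, hpos, by linarith, by linarith, hS⟩

/-- positive definite forms -/
abbrev XX (N : ℤ) := {Q : ℤ × ℤ × ℤ // formDisc Q = -N ∧ IsPosDef Q}

/-- the action on `XX N` -/
def actX {N : ℤ} (γ : GG) (Q : XX N) : XX N :=
  ⟨formAct γ Q.1, by rw [formDisc_act]; exact Q.2.1, posDef_act γ _ Q.2.2⟩

theorem mk_eq_iff {N : ℤ} (Q Q' : XX N) : (Quot.mk _ Q : FormClasses N) = Quot.mk _ Q' ↔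
    ∃ γ : GG, formAct γ Q.1 = Q'.1 := by
  have heq : Equivalence (fun (Q Q' : XX N) => ∃ γ : GG, formAct γ Q.1 = Q'.1) := by
    refine ⟨fun Q => ⟨1, formAct_one _⟩, ?_, ?_⟩
    · rintro Q Q' ⟨γ, h⟩
      exact ⟨γ⁻¹, by rw [← h, ← formAct_mul, mul_inv_cancel, formAct_one]⟩
    · rintro Q Q' Q'' ⟨γ, h⟩ ⟨δ, h'⟩
      exact ⟨γ * δ, by rw [formAct_mul, h, h']⟩
  constructor
  · intro h
    exact heq.eqvGen_iff.1 (Quot.eqvGen_exact h)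
  · intro h
    exact Quot.sound h

/-- reduced forms -/
abbrev RT (N : ℤ) := {Q : XX N // Red Q.1}

theorem fiber_card (N : ℤ) (hN : ∀ k : ℤ, N ≠ 3 * k ^ 2) (Q0 : XX N) :
    Nat.card {Q : RT N // (Quot.mk _ Q.1 : FormClasses N) = Quot.mk _ Q0}
      * Nat.card {γ : GG // formAct γ Q0.1 = Q0.1} = 4 := by
  obtain ⟨δ, a, b, c, h, ha, h1, h2, h3⟩ := exists_red Q0.1 Q0.2.2
  have hd : 4 * a * c - b ^ 2 = N := by
    have := formDisc_act δ Q0.1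
    rw [h, Q0.2.1] at this
    simp only [formDisc] at this
    linarith
  have h4 := card_red a b c ha h1 h2 h3 (by rw [hd]; exact hN)
  rw [← h4, ← Nat.card_prod]
  have hch : ∀ Q : {Q : RT N // (Quot.mk _ Q.1 : FormClasses N) = Quot.mk _ Q0},
      ∃ γ : GG, formAct γ Q0.1 = Q.1.1.1 := fun Q => (mk_eq_iff _ _).1 Q.2.symm
  choose f hf using hch
  have hback : formAct δ⁻¹ (a, b, c) = Q0.1 := by
    rw [← h, ← formAct_mul, mul_inv_cancel, formAct_one]
  refine Nat.card_congr (Equiv.ofBijective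
    (fun p => ⟨δ⁻¹ * (p.2.1 * f p.1), ?_⟩) ⟨?_, ?_⟩)
  · rw [formAct_mul, hback, formAct_mul, p.2.2, hf]
    exact p.1.1.2
  · rintro ⟨Q, s, hs⟩ ⟨Q', s', hs'⟩ he
    have he' : s * f Q = s' * f Q' := by
      have := congrArg Subtype.val he
      exact mul_left_cancel this
    have hQ : Q = Q' := by
      apply Subtype.ext; apply Subtype.ext; apply Subtype.ext
      rw [← hf Q, ← hf Q']
      calc formAct (f Q) Q0.1 = formAct (s * f Q) Q0.1 := by rw [formAct_mul, hs]
        _ = formAct (s' * f Q') Q0.1 := by rw [he']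
        _ = _ := by rw [formAct_mul, hs']
    subst hQ
    have : s = s' := mul_right_cancel he'
    subst this
    rfl
  · rintro ⟨γ, hγ⟩
    have e1 : formAct (δ * γ) Q0.1 = formAct γ (a, b, c) := by rw [formAct_mul, h]
    let Q : {Q : RT N // (Quot.mk _ Q.1 : FormClasses N) = Quot.mk _ Q0} :=
      ⟨⟨actX (δ * γ) Q0, by simp only [actX]; rw [e1]; exact hγ⟩,
        ((mk_eq_iff _ _).2 ⟨δ * γ, rfl⟩).symm⟩
    refine ⟨(Q, ⟨δ * γ * (f Q)⁻¹, ?_⟩), ?_⟩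
    · rw [formAct_mul]
      have : formAct (δ * γ) Q0.1 = formAct (f Q) Q0.1 := (hf Q).symm
      rw [this, ← formAct_mul, mul_inv_cancel, formAct_one]
    · apply Subtype.ext
      simp [mul_assoc]

/-- reduced forms, as a finset -/
noncomputable def RF (N : ℤ) : Finset (ℤ × ℤ × ℤ) :=
  (Finset.Icc (-N) N ×ˢ Finset.Icc (-N) N ×ˢ Finset.Icc (-N) N).filter
    (fun Q => formDisc Q = -N ∧ Red Q)

theorem red_bound {Q : ℤ × ℤ × ℤ} (h : Red Q) : 3 * (Q.1 * Q.2.2) ≤ - formDisc Q := by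
  obtain ⟨r1, r2, r3, r4, r5, r6⟩ := h
  have := sq_le_of_bounds r1 r2 r3 r4 r5.le r6.le
  unfold formDisc
  nlinarith

theorem mem_RF {N : ℤ} {Q : ℤ × ℤ × ℤ} : Q ∈ RF N ↔ formDisc Q = -N ∧ Red Q := by
  simp only [RF, Finset.mem_filter, Finset.mem_product, Finset.mem_Icc]
  constructor
  · exact fun h => h.2
  · intro h
    refine ⟨?_, h⟩
    have hb := red_bound h.2
    obtain ⟨h, r1, r2, r3, r4, r5, r6⟩ := h
    rw [h, neg_neg] at hb
    have : Q.1 ≤ Q.1 * Q.2.2 := by nlinarith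
    have : Q.2.2 ≤ Q.1 * Q.2.2 := by nlinarith
    refine ⟨⟨?_, ?_⟩, ⟨?_, ?_⟩, ⟨?_, ?_⟩⟩ <;> omega

theorem red_posDef {Q : ℤ × ℤ × ℤ} (h : Red Q) : IsPosDef Q := by
  refine ⟨h.1, ?_⟩
  have := red_bound h
  have := mul_pos h.1 h.2.1
  linarith

theorem card_RT (N : ℤ) : Nat.card (RT N) = (RF N).card := by
  rw [← Fintype.card_coe, ← Nat.card_eq_fintype_card]
  refine Nat.card_congr ⟨fun Q => ⟨Q.1.1, mem_RF.2 ⟨Q.1.2.1, Q.2⟩⟩,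
    fun Q => ⟨⟨Q.1, (mem_RF.1 Q.2).1, red_posDef (mem_RF.1 Q.2).2⟩, (mem_RF.1 Q.2).2⟩,
    fun _ => rfl, fun _ => rfl⟩

instance (N : ℤ) : Finite (RT N) :=
  Finite.of_injective (fun Q : RT N => (⟨Q.1.1, mem_RF.2 ⟨Q.1.2.1, Q.2⟩⟩ : RF N)) (by
    intro Q Q' h
    apply Subtype.ext; apply Subtype.ext
    simpa using h)

theorem hurwitz_eq (N : ℤ) (hN : ∀ k : ℤ, N ≠ 3 * k ^ 2) :
    hurwitzClassNumber N = ((RF N).card : ℝ) / 2 := by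
  have hN0 : N ≠ 0 := by simpa using hN 0
  rw [hurwitzClassNumber, if_neg hN0]
  let π : RT N → FormClasses N := fun Q => Quot.mk _ Q.1
  have hsurj : Function.Surjective π := by
    intro c
    induction c using Quot.ind with
    | mk Q =>
      obtain ⟨δ, a, b, c, h, ha, h1, h2, h3⟩ := exists_red Q.1 Q.2.2
      refine ⟨⟨actX δ Q, ?_⟩, ?_⟩
      · simp only [actX]; rw [h]
        refine ⟨?_, ?_, ?_, ?_, ?_, ?_⟩ <;> simp only <;> omega
      · exact ((mk_eq_iff _ _).2 ⟨δ, rfl⟩).symm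
  have : Finite (FormClasses N) := Finite.of_surjective π hsurj
  have := Fintype.ofFinite (FormClasses N)
  rw [finsum_eq_sum_of_fintype, ← card_RT, ← Nat.card_congr (Equiv.sigmaFiberEquiv π),
    Nat.card_sigma, Nat.cast_sum, Finset.sum_div]
  refine Finset.sum_congr rfl fun c _ => ?_
  have := fiber_card N hN c.out
  rw [Quot.out_eq] at this
  have h' : (Nat.card {Q : RT N // π Q = c} : ℝ)
      * Nat.card {γ : GG // formAct γ c.out.1 = c.out.1} = 4 := by exact_mod_cast this
  have hne : (Nat.card {γ : GG // formAct γ c.out.1 = c.out.1} : ℝ) ≠ 0 := by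
    intro h0; rw [h0] at h'; norm_num at h'
  field_simp
  linarith


theorem not_three_sq (n : ℕ) (h3 : ¬ 3 ∣ n) (t : ℤ) (ht : t % 3 = 0) (k : ℤ) :
    4 * (n : ℤ) - t ^ 2 ≠ 3 * k ^ 2 := by
  intro h
  obtain ⟨s, rfl⟩ : (3 : ℤ) ∣ t := by omega
  have : (3 : ℤ) ∣ n := by
    have h' : (n : ℤ) = 3 * (k ^ 2 + 3 * s ^ 2 - n) := by linarith
    exact ⟨_, h'⟩
  exact h3 (by exact_mod_cast this)

theorem RF_neg {N : ℤ} (hN : N ≤ 0) : (RF N).card = 0 := by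
  rw [Finset.card_eq_zero, Finset.eq_empty_iff_forall_notMem]
  intro Q hQ
  obtain ⟨h1, h2⟩ := mem_RF.1 hQ
  have := red_bound h2
  have := mul_pos h2.1 h2.2.1
  linarith

theorem par {t h k m n : ℤ} (hd : h ^ 2 - 4 * k * m = -(4 * n - t ^ 2)) :
    ∃ a d : ℤ, t = a + d ∧ h = a - d := by
  have hp : Even (t + h) := by
    have h1 : Even (t ^ 2 + h ^ 2) := ⟨h ^ 2 - 2 * k * m + 2 * n, by linarith⟩
    rw [Int.even_add, Int.even_pow' two_ne_zero, Int.even_pow' two_ne_zero] at h1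
    rwa [Int.even_add]
  obtain ⟨a, ha⟩ := hp
  exact ⟨a, t - a, by ring, by linarith⟩

theorem sum_RF (n : ℕ) : ∑ t ∈ (Finset.Icc (-(4 * n : ℤ)) (4 * n)).filter (fun t => t % 3 = 0),
    (RF (4 * n - t ^ 2)).card = (RR n).card := by
  rw [← Finset.card_sigma]
  refine Finset.card_nbij' (fun x => (x.2.1, x.2.2.2, (x.1 + x.2.2.1) / 2, (x.1 - x.2.2.1) / 2))
    (fun y => ⟨y.2.2.1 + y.2.2.2, (y.1, y.2.2.1 - y.2.2.2, y.2.1)⟩) ?_ ?_ ?_ ?_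
  · rintro ⟨t, u, h, g⟩ hx
    simp only [Finset.coe_sigma, Set.mem_sigma_iff, Finset.mem_coe, Finset.mem_filter, mem_RF, formDisc, Red] at hx ⊢
    obtain ⟨⟨_, ht⟩, hd, r1, r2, r3, r4, r5, r6⟩ := hx
    obtain ⟨a, d, rfl, rfl⟩ := par hd
    rw [show (a + d + (a - d)) / 2 = a by omega, show (a + d - (a - d)) / 2 = d by omega]
    exact mem_RR.2 ⟨r1, r2, by linarith, ht, r3, r4, r5, r6⟩
  · rintro ⟨u, g, a, d⟩ hx
    have hx0 := hx
    simp only [RR, Finset.coe_filter, Set.mem_setOf_eq, Finset.mem_product, Finset.mem_Icc] at hx0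
    have hx' := mem_RR.1 hx
    obtain ⟨h1, h2, h3, h4, h5, h6, h7, h8⟩ := hx'
    have hh := sq_le_of_bounds h1 h2 h5 h6 h7.le h8.le
    have e : 4 * (n : ℤ) ≥ 3 * (u * g) + (a + d) ^ 2 := by nlinarith
    have hug : 0 < u * g := mul_pos h1 h2
    have f3 : a + d ≤ 4 * n := by nlinarith [sq_nonneg (a + d - 1)]
    have f4 : -(a + d) ≤ 4 * n := by nlinarith [sq_nonneg (a + d + 1)]
    simp only [Finset.coe_sigma, Set.mem_sigma_iff, Finset.mem_coe, Finset.mem_filter, mem_RF, formDisc, Red,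
      Finset.mem_Icc]
    refine ⟨⟨⟨by omega, by omega⟩, h4⟩, by linarith, h1, h2, h5, h6, h7, h8⟩
  · rintro ⟨t, u, h, g⟩ hx
    simp only [Finset.coe_sigma, Set.mem_sigma_iff, Finset.mem_coe, Finset.mem_filter, mem_RF, formDisc, Red] at hx ⊢
    obtain ⟨⟨_, ht⟩, hd, r1, r2, r3, r4, r5, r6⟩ := hx
    obtain ⟨a, d, rfl, rfl⟩ := par hd
    rw [show (a + d + (a - d)) / 2 = a by omega, show (a + d - (a - d)) / 2 = d by omega]
  · rintro ⟨u, g, a, d⟩ hx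
    simp only [Prod.mk.injEq]
    refine ⟨trivial, trivial, ?_, ?_⟩ <;> omega

theorem HH_eq (n : ℕ) (h3 : ¬ 3 ∣ n) : HH 0 0 3 n = ((RR n).card : ℝ) / 2 := by
  rw [← sum_RF, Nat.cast_sum, Finset.sum_div, Finset.sum_filter]
  unfold HH
  have e : ∀ t : ℤ, (if t % ((3 : ℕ) : ℤ) = 0 % ((3 : ℕ) : ℤ) then
      (t : ℝ) ^ 0 * hurwitzClassNumber (4 * n - t ^ 2) else 0)
      = if t % 3 = 0 then ((RF (4 * n - t ^ 2)).card : ℝ) / 2 else 0 := by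
    intro t
    norm_num
    split_ifs with h
    · exact hurwitz_eq _ (not_three_sq n h3 t (by omega))
    · rfl
  rw [finsum_congr e]
  refine finsum_eq_sum_of_support_subset _ ?_
  intro t ht
  rw [Function.mem_support] at ht
  rw [Finset.mem_coe, Finset.mem_Icc]
  by_contra hcon
  apply ht
  have : 4 * (n : ℤ) - t ^ 2 ≤ 0 := by
    by_cases h : t < -(4 * n : ℤ)
    · nlinarith
    · have : 4 * (n : ℤ) < t := by omega
      nlinarith
  rw [RF_neg this]
  simp

/-- Lemma 4.1 (1): for `3 ∤ n`,
`H_{0,3}(n) = σ(n)/2` if `n ≡ 1 (mod 3)`, and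
`H_{0,3}(n) = σ(n) - 2 ∑_{d∣n, d²<n} d` if `n ≡ 2 (mod 3)`. -/
theorem class_number_sum_m_zero (n : ℕ) (hn : 0 < n) (h3 : ¬ 3 ∣ n) :
    (n % 3 = 1 → HH 0 0 3 n = (∑ d ∈ n.divisors, (d : ℝ)) / 2)
    ∧ (n % 3 = 2 → HH 0 0 3 n =
        (∑ d ∈ n.divisors, (d : ℝ))
          - 2 * ∑ d ∈ n.divisors.filter (fun d => d ^ 2 < n), (d : ℝ)) := by
  rw [HH_eq n h3]
  refine ⟨fun h1 => ?_, fun h2 => ?_⟩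
  · have e : ((RR n).card : ℝ) = ∑ d ∈ n.divisors, (d : ℝ) := by
      have := congrArg (fun x : ℤ => (x : ℝ)) (card_RR_one n h1)
      push_cast at this
      exact this
    rw [e]
  · have e : ((RR n).card : ℝ) = 2 * (∑ d ∈ n.divisors, (d : ℝ))
        - 4 * ∑ d ∈ n.divisors.filter (fun d => d ^ 2 < n), (d : ℝ) := by
      have := congrArg (fun x : ℤ => (x : ℝ)) (card_RR_two n h2)
      push_cast at this
      exact this
    rw [e]
    ring

end HurwitzPaper
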